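/- For every α ∈ [0.93, 1.76] and every t ∈ (0, t_α), ∂⁴h_α(p(·,t))/∂t⁴ ≤ 0. -/

import Mathlib

open MeasureTheory Real Filter
open scoped Classical

/-- The density `p(x,t)` of `X + √t Z` along the heat flow. -/
noncomputable def heatP (f : ℝ → ℝ) (t x : ℝ) : ℝ :=
  ∫ y : ℝ, f y * ((Real.sqrt (2 * Real.pi * t))⁻¹ * Real.exp (-(x - y) ^ 2 / (2 * t)))

/-- `p_k(x,t) = ∂^k p / ∂x^k`. -/
noncomputable def pk (f : ℝ → ℝ) (k : ℕ) (t x : ℝ) : ℝ :=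
  iteratedDeriv k (heatP f t) x

/-- `p̄_i = p_i / p`. -/
noncomputable def pbar (f : ℝ → ℝ) (i : ℕ) (t x : ℝ) : ℝ :=
  pk f i t x / heatP f t x

/-- The Rényi entropy `h_α(p(·,t))`, with the Shannon entropy at `α = 1`. -/
noncomputable def renyiEnt (f : ℝ → ℝ) (α t : ℝ) : ℝ :=
  if α = 1 then -∫ x : ℝ, heatP f t x * Real.log (heatP f t x)
  else (1 - α)⁻¹ * Real.log (∫ x : ℝ, heatP f t x ^ α)

/-- Finiteness `|h_α(p(·,t))| < ∞` of the Rényi entropy at time `t`. -/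
def renyiFinite (f : ℝ → ℝ) (α t : ℝ) : Prop :=
  if α = 1 then Integrable (fun x : ℝ => heatP f t x * Real.log (heatP f t x))
  else Integrable (fun x : ℝ => heatP f t x ^ α) ∧ 0 < ∫ x : ℝ, heatP f t x ^ α

/-- `t < t_α` where `t_α = sup { s > 0 : |h_α(p(·,s))| < ∞ }`. -/
def ltTalpha (f : ℝ → ℝ) (α t : ℝ) : Prop :=
  ∃ s : ℝ, t < s ∧ 0 < s ∧ renyiFinite f α s

/-- The tilted expectation `E_α[g] = (∫ g p^α) / (∫ p^α)`. -/
noncomputable def Ea (f : ℝ → ℝ) (α t : ℝ) (g : ℝ → ℝ) : ℝ :=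
  (∫ x : ℝ, g x * heatP f t x ^ α) / (∫ x : ℝ, heatP f t x ^ α)


/-! ### Gaussian moment integrals -/

/-- Unnormalised Gaussian moments of the mixture. -/
noncomputable def QQ (f : ℝ → ℝ) (j : ℕ) (t x : ℝ) : ℝ :=
  ∫ y : ℝ, f y * ((x - y) ^ j * Real.exp (-(x - y) ^ 2 / (2 * t)))

lemma kernel_bound (j : ℕ) {b s : ℝ} (hb : 0 < b) (hbs : b < s) :
    ∃ C : ℝ, 0 ≤ C ∧ ∀ t, 0 < t → t ≤ b → ∀ z : ℝ,
      |z| ^ j * Real.exp (-z ^ 2 / (2 * t)) ≤ C * Real.exp (-z ^ 2 / (2 * s)) := by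
  have hs : 0 < s := hb.trans hbs
  set κ : ℝ := 1 / (2 * b) - 1 / (2 * s) with hκ
  have hκ0 : 0 < κ := by
    rw [hκ, sub_pos]
    exact one_div_lt_one_div_of_lt (by positivity) (by linarith)
  refine ⟨1 + (j.factorial : ℝ) / κ ^ j, by positivity, ?_⟩
  intro t ht htb z
  have h1 : |z| ^ j ≤ (1 + (j.factorial : ℝ) / κ ^ j) * Real.exp (κ * z ^ 2) := by
    have hx : 0 ≤ κ * z ^ 2 := by positivity
    have h2 := Real.pow_div_factorial_le_exp _ hx j
    have h3 : |z| ^ j ≤ 1 + (z ^ 2) ^ j := by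
      have : (z ^ 2) ^ j = (|z| ^ j) ^ 2 := by
        rw [← sq_abs z]; ring
      rw [this]
      nlinarith [sq_nonneg (|z| ^ j - 1), pow_nonneg (abs_nonneg z) j]
    have h4 : (z ^ 2) ^ j ≤ (j.factorial : ℝ) / κ ^ j * Real.exp (κ * z ^ 2) := by
      rw [mul_pow, div_le_iff₀ (by positivity)] at h2
      rw [div_mul_eq_mul_div, le_div_iff₀ (by positivity)]
      linarith
    have h5 : 1 ≤ Real.exp (κ * z ^ 2) := Real.one_le_exp hx
    linarith
  have h6 : Real.exp (-z ^ 2 / (2 * t)) ≤ Real.exp (-z ^ 2 / (2 * b)) := by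
    apply Real.exp_le_exp.mpr
    rw [neg_div, neg_div, neg_le_neg_iff]
    exact div_le_div_of_nonneg_left (by positivity) (by positivity) (by linarith)
  have h7 : Real.exp (-z ^ 2 / (2 * b)) = Real.exp (-z ^ 2 / (2 * s)) * (Real.exp (κ * z ^ 2))⁻¹ := by
    rw [← Real.exp_neg, ← Real.exp_add]
    congr 1
    rw [hκ]; field_simp; ring
  calc |z| ^ j * Real.exp (-z ^ 2 / (2 * t))
      ≤ ((1 + (j.factorial : ℝ) / κ ^ j) * Real.exp (κ * z ^ 2)) *
          (Real.exp (-z ^ 2 / (2 * s)) * (Real.exp (κ * z ^ 2))⁻¹) := by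
        rw [← h7]
        exact mul_le_mul h1 h6 (Real.exp_pos _).le (by positivity)
    _ = _ := by
        field_simp

lemma kernel_bound' (j : ℕ) {b : ℝ} (hb : 0 < b) :
    ∃ C : ℝ, 0 ≤ C ∧ ∀ t, 0 < t → t ≤ b → ∀ z : ℝ,
      |z ^ j * Real.exp (-z ^ 2 / (2 * t))| ≤ C := by
  obtain ⟨C, hC, h⟩ := kernel_bound j hb (show b < 2 * b by linarith)
  refine ⟨C, hC, fun t ht htb z => ?_⟩
  rw [abs_mul, abs_pow, abs_of_pos (Real.exp_pos _)]
  refine (h t ht htb z).trans ?_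
  have : Real.exp (-z ^ 2 / (2 * (2 * b))) ≤ 1 := by
    apply Real.exp_le_one_iff.mpr
    apply div_nonpos_of_nonpos_of_nonneg <;> nlinarith [sq_nonneg z]
  nlinarith

section Q
variable {f : ℝ → ℝ}

lemma QQ_integrable (hfi : Integrable f) (j : ℕ) {t : ℝ} (ht : 0 < t) (x : ℝ) :
    Integrable (fun y => f y * ((x - y) ^ j * Real.exp (-(x - y) ^ 2 / (2 * t)))) := by
  obtain ⟨C, hC, h⟩ := kernel_bound' j ht
  refine hfi.mul_bdd (c := C) ?_ ?_
  · exact (by fun_prop : Continuous fun y => ((x - y) ^ j * Real.exp (-(x - y) ^ 2 / (2 * t)))).aestronglyMeasurable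
  · exact Eventually.of_forall fun y => h t ht le_rfl (x - y)

lemma QQ_pos (hf0 : ∀ x, 0 ≤ f x) (hf1 : (∫ x : ℝ, f x) = 1) (hfi : Integrable f)
    {t : ℝ} (ht : 0 < t) (x : ℝ) : 0 < QQ f 0 t x := by
  unfold QQ
  rw [integral_pos_iff_support_of_nonneg _ (QQ_integrable hfi 0 ht x)]
  · have : Function.support (fun y => f y * ((x - y) ^ 0 * Real.exp (-(x - y) ^ 2 / (2 * t))))
        = Function.support f := by
      ext y
      simp [Real.exp_ne_zero]
    rw [this, ← integral_pos_iff_support_of_nonneg (fun x => hf0 x) hfi, hf1]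
    norm_num
  · intro y
    have := hf0 y
    simp only [Pi.zero_apply]
    positivity

lemma QQ_mono (hf0 : ∀ x, 0 ≤ f x) (hfi : Integrable f)
    {t s : ℝ} (ht : 0 < t) (hts : t ≤ s) (x : ℝ) : QQ f 0 t x ≤ QQ f 0 s x := by
  apply integral_mono (QQ_integrable hfi 0 ht x) (QQ_integrable hfi 0 (ht.trans_le hts) x)
  intro y
  simp only [pow_zero, one_mul]
  apply mul_le_mul_of_nonneg_left _ (hf0 y)
  apply Real.exp_le_exp.mpr
  rw [neg_div, neg_div, neg_le_neg_iff]
  exact div_le_div_of_nonneg_left (by positivity) (by positivity) (by linarith)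

lemma QQ_hasDerivAt_x (hfi : Integrable f) (j : ℕ) {t : ℝ} (ht : 0 < t) (x : ℝ) :
    HasDerivAt (fun x => QQ f j t x) (j * QQ f (j - 1) t x - QQ f (j + 1) t x / t) x := by
  obtain ⟨C1, hC1, h1⟩ := kernel_bound' (j - 1) ht
  obtain ⟨C2, hC2, h2⟩ := kernel_bound' (j + 1) ht
  have key := (hasDerivAt_integral_of_dominated_loc_of_deriv_le (μ := volume) (𝕜 := ℝ)
    (F := fun x y => f y * ((x - y) ^ j * Real.exp (-(x - y) ^ 2 / (2 * t))))
    (F' := fun x y => f y * (j * ((x - y) ^ (j - 1) * Real.exp (-(x - y) ^ 2 / (2 * t)))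
      - ((x - y) ^ (j + 1) * Real.exp (-(x - y) ^ 2 / (2 * t))) / t))
    (bound := fun y => |f y| * (j * C1 + C2 / t))
    (x₀ := x) (s := Set.univ) Filter.univ_mem ?_ ?_ ?_ ?_ ?_ ?_).2
  · refine key.congr_deriv ?_
    unfold QQ
    symm; rw [← integral_const_mul, ← integral_div, ← integral_sub]
    · congr 1; ext y; ring
    · exact (QQ_integrable hfi (j - 1) ht x).const_mul _
    · exact (QQ_integrable hfi (j + 1) ht x).div_const _
  · exact Eventually.of_forall fun x => (QQ_integrable hfi j ht x).aestronglyMeasurable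
  · exact QQ_integrable hfi j ht x
  · refine AEStronglyMeasurable.mul hfi.aestronglyMeasurable ?_
    exact (by fun_prop : Continuous fun y => (j * ((x - y) ^ (j - 1) * Real.exp (-(x - y) ^ 2 / (2 * t)))
      - ((x - y) ^ (j + 1) * Real.exp (-(x - y) ^ 2 / (2 * t))) / t)).aestronglyMeasurable
  · refine Eventually.of_forall fun y x _ => ?_
    rw [norm_mul, Real.norm_eq_abs, Real.norm_eq_abs]
    apply mul_le_mul_of_nonneg_left _ (abs_nonneg _)
    refine (abs_sub _ _).trans ?_
    rw [abs_mul, abs_div, abs_of_pos ht, Nat.abs_cast]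
    have := h1 t ht le_rfl (x - y)
    have := h2 t ht le_rfl (x - y)
    gcongr
  · exact hfi.abs.mul_const _
  · refine Eventually.of_forall fun y x _ => ?_
    have hz : HasDerivAt (fun x : ℝ => x - y) 1 x := (hasDerivAt_id x).sub_const y
    have := ((hz.pow j).mul (((hz.pow 2).neg.div_const (2 * t)).exp)).const_mul (f y)
    refine this.congr_deriv ?_
    symm
    simp only [Pi.pow_apply, Pi.neg_apply]
    field_simp
    ring

lemma QQ_hasDerivAt_t (hfi : Integrable f) (j : ℕ) {t : ℝ} (ht : 0 < t) (x : ℝ) :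
    HasDerivAt (fun t => QQ f j t x) (QQ f (j + 2) t x / (2 * t ^ 2)) t := by
  obtain ⟨C2, hC2, h2⟩ := kernel_bound' (j + 2) (show 0 < 2 * t by linarith)
  have hmem : Set.Ioo (t / 2) (2 * t) ∈ nhds t := Ioo_mem_nhds (by linarith) (by linarith)
  have key := (hasDerivAt_integral_of_dominated_loc_of_deriv_le (μ := volume) (𝕜 := ℝ)
    (F := fun t y => f y * ((x - y) ^ j * Real.exp (-(x - y) ^ 2 / (2 * t))))
    (F' := fun t y => f y * (((x - y) ^ (j + 2) * Real.exp (-(x - y) ^ 2 / (2 * t))) / (2 * t ^ 2)))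
    (bound := fun y => |f y| * (C2 / (2 * (t / 2) ^ 2)))
    (x₀ := t) (s := Set.Ioo (t / 2) (2 * t)) hmem ?_ ?_ ?_ ?_ ?_ ?_).2
  · refine key.congr_deriv ?_
    unfold QQ
    symm; rw [← integral_div]
    congr 1; ext y; ring
  · filter_upwards [hmem] with τ hτ
    exact (QQ_integrable hfi j (by linarith [hτ.1]) x).aestronglyMeasurable
  · exact QQ_integrable hfi j ht x
  · refine AEStronglyMeasurable.mul hfi.aestronglyMeasurable ?_
    exact (by fun_prop : Continuous fun y => ((x - y) ^ (j + 2) * Real.exp (-(x - y) ^ 2 / (2 * t))) / (2 * t ^ 2)).aestronglyMeasurable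
  · refine Eventually.of_forall fun y τ hτ => ?_
    have hτ0 : 0 < τ := by linarith [hτ.1]
    rw [norm_mul, Real.norm_eq_abs, Real.norm_eq_abs]
    apply mul_le_mul_of_nonneg_left _ (abs_nonneg _)
    rw [abs_div, abs_of_pos (show 0 < 2 * τ ^ 2 by positivity)]
    have := h2 τ hτ0 hτ.2.le (x - y)
    have := hτ.1.le
    gcongr
  · exact hfi.abs.mul_const _
  · refine Eventually.of_forall fun y τ hτ => ?_
    have hτ0 : 0 < τ := by linarith [hτ.1]
    have hz : HasDerivAt (fun τ : ℝ => -(x - y) ^ 2 / (2 * τ)) (-(x - y) ^ 2 * (-2 / (2 * τ) ^ 2)) τ := by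
      have h3 := (((hasDerivAt_id τ).const_mul 2).fun_inv (by simp; positivity)).const_mul (-(x - y) ^ 2)
      refine h3.congr_deriv ?_
      simp
    have := ((hz.exp).const_mul ((x - y) ^ j)).const_mul (f y)
    refine this.congr_deriv ?_
    field_simp
    ring

/-- Ratios `Q_j / Q_0`. -/
noncomputable def mu (f : ℝ → ℝ) (j : ℕ) (t x : ℝ) : ℝ := QQ f j t x / QQ f 0 t x

lemma mu_hasDerivAt_x (hf0 : ∀ x, 0 ≤ f x) (hf1 : (∫ x : ℝ, f x) = 1) (hfi : Integrable f)
    (j : ℕ) {t : ℝ} (ht : 0 < t) (x : ℝ) :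
    HasDerivAt (fun x => mu f j t x)
      (j * mu f (j - 1) t x - mu f (j + 1) t x / t + mu f j t x * mu f 1 t x / t) x := by
  have hp := QQ_pos hf0 hf1 hfi ht x
  have := (QQ_hasDerivAt_x hfi j ht x).div (QQ_hasDerivAt_x hfi 0 ht x) hp.ne'
  refine this.congr_deriv ?_
  symm
  simp only [mu, Nat.cast_zero, zero_mul, zero_sub, zero_add]
  field_simp
  ring

lemma mu_hasDerivAt_t (hf0 : ∀ x, 0 ≤ f x) (hf1 : (∫ x : ℝ, f x) = 1) (hfi : Integrable f)
    (j : ℕ) {t : ℝ} (ht : 0 < t) (x : ℝ) :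
    HasDerivAt (fun t => mu f j t x)
      ((mu f (j + 2) t x - mu f j t x * mu f 2 t x) / (2 * t ^ 2)) t := by
  have hp := QQ_pos hf0 hf1 hfi ht x
  have := (QQ_hasDerivAt_t hfi j ht x).div (QQ_hasDerivAt_t hfi 0 ht x) hp.ne'
  refine this.congr_deriv ?_
  symm
  simp only [mu, zero_add]
  field_simp

/-- The key pointwise bound. -/
lemma mu_bound (hf0 : ∀ x, 0 ≤ f x) (hf1 : (∫ x : ℝ, f x) = 1) (hfi : Integrable f)
    (j : ℕ) {b s : ℝ} (hb : 0 < b) (hbs : b < s) {η : ℝ} (hη : 0 < η) :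
    ∃ C : ℝ, 0 ≤ C ∧ ∀ t, 0 < t → t ≤ b → ∀ x,
      |mu f j t x| ≤ C * (QQ f 0 s x / QQ f 0 t x) ^ η := by
  obtain ⟨n, hn⟩ := exists_nat_gt (1 / η)
  have hn0 : (0:ℝ) < n := lt_trans (by positivity) hn
  have hn1 : n ≠ 0 := by rintro rfl; simp at hn0
  obtain ⟨C, hC, h⟩ := kernel_bound (j * n) hb hbs
  refine ⟨1 + C, by linarith, fun t ht htb x => ?_⟩
  have hs : 0 < s := hb.trans hbs
  have hpt := QQ_pos hf0 hf1 hfi ht x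
  have hps := QQ_pos hf0 hf1 hfi hs x
  have hr1 : 1 ≤ QQ f 0 s x / QQ f 0 t x := by
    rw [one_le_div hpt]; exact QQ_mono hf0 hfi ht (by linarith) x
  set r := QQ f 0 s x / QQ f 0 t x with hr
  have hr0 : 0 < r := by linarith
  set ρ := r ^ (1 / (n:ℝ)) with hρ
  have hρ0 : 0 < ρ := Real.rpow_pos_of_pos hr0 _
  have hρn : ρ ^ n = r := by
    rw [hρ, ← Real.rpow_natCast, ← Real.rpow_mul hr0.le]
    rw [one_div_mul_cancel hn0.ne', Real.rpow_one]
  have hρη : ρ ≤ r ^ η := by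
    apply Real.rpow_le_rpow_of_exponent_le hr1
    rw [div_le_iff₀ hn0]
    rw [div_lt_iff₀ hη] at hn
    linarith
  -- pointwise
  have hpt2 : ∀ z : ℝ, |z| ^ j ≤ ρ + |z| ^ (j * n) * (ρ / r) := by
    intro z
    by_cases hz : |z| ^ j ≤ ρ
    · have : 0 ≤ |z| ^ (j * n) * (ρ / r) := by positivity
      linarith
    · push Not at hz
      have h1 : ρ ^ (n - 1) ≤ (|z| ^ j) ^ (n - 1) := pow_le_pow_left₀ hρ0.le hz.le _
      have h2 : r = ρ ^ (n - 1) * ρ := by rw [← pow_succ, Nat.sub_add_cancel (Nat.one_le_iff_ne_zero.mpr hn1), hρn]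
      have h3 : |z| ^ (j * n) = (|z| ^ j) ^ (n - 1) * |z| ^ j := by
        rw [← pow_succ, Nat.sub_add_cancel (Nat.one_le_iff_ne_zero.mpr hn1), pow_mul]
      have h4 : |z| ^ j ≤ |z| ^ (j * n) * (ρ / r) := by
        rw [h3, h2, mul_div_assoc', le_div_iff₀ (by positivity)]
        have : 0 ≤ |z| ^ j := by positivity
        calc |z| ^ j * (ρ ^ (n - 1) * ρ) = ρ ^ (n - 1) * (|z| ^ j * ρ) := by ring
          _ ≤ (|z| ^ j) ^ (n - 1) * (|z| ^ j * ρ) := by gcongr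
          _ = _ := by ring
      linarith
  have hQ : |QQ f j t x| ≤ ρ * QQ f 0 t x + (ρ / r * C) * QQ f 0 s x := by
    unfold QQ
    rw [← integral_const_mul, ← integral_const_mul, ← integral_add, ← Real.norm_eq_abs]
    · apply norm_integral_le_of_norm_le
      · exact ((QQ_integrable hfi 0 ht x).const_mul _).add ((QQ_integrable hfi 0 hs x).const_mul _)
      · refine Eventually.of_forall fun y => ?_
        rw [Real.norm_eq_abs, abs_mul, abs_mul, abs_of_nonneg (hf0 y), abs_pow, abs_of_pos (Real.exp_pos _)]
        have h1 := hpt2 (x - y)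
        have h2 := h t ht htb (x - y)
        have h3 := hf0 y
        have h4 : |x - y| ^ j * Real.exp (-(x - y) ^ 2 / (2 * t)) ≤
            ρ * Real.exp (-(x - y) ^ 2 / (2 * t)) + ρ / r * (C * Real.exp (-(x - y) ^ 2 / (2 * s))) := by
          calc |x - y| ^ j * Real.exp (-(x - y) ^ 2 / (2 * t))
              ≤ (ρ + |x - y| ^ (j * n) * (ρ / r)) * Real.exp (-(x - y) ^ 2 / (2 * t)) := by gcongr
            _ = ρ * Real.exp (-(x - y) ^ 2 / (2 * t)) +
                ρ / r * (|x - y| ^ (j * n) * Real.exp (-(x - y) ^ 2 / (2 * t))) := by ring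
            _ ≤ _ := by gcongr
        calc f y * (|x - y| ^ j * Real.exp (-(x - y) ^ 2 / (2 * t))) ≤ f y * _ :=
              mul_le_mul_of_nonneg_left h4 h3
          _ = _ := by simp only [pow_zero]; ring
    · exact (QQ_integrable hfi 0 ht x).const_mul _
    · exact (QQ_integrable hfi 0 hs x).const_mul _
  have hQ2 : |mu f j t x| ≤ (1 + C) * ρ := by
    rw [mu, abs_div, abs_of_pos hpt, div_le_iff₀ hpt]
    refine hQ.trans (le_of_eq ?_)
    rw [hr]; field_simp
  exact hQ2.trans (by gcongr)

end Q

/-! ### The class of tame functions -/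

/-- Standing hypotheses. -/
structure Ctx (f : ℝ → ℝ) (α a b s : ℝ) : Prop where
  hf0 : ∀ x, 0 ≤ f x
  hf1 : (∫ x : ℝ, f x) = 1
  hfi : Integrable f
  ha : 0 < a
  hab : a < b
  hbs : b < s
  hα : 1 / 2 ≤ α
  hintg : Integrable (fun x => QQ f 0 s x ^ α)

/-- Functions bounded by every positive power of the ratio `Q_s / Q_t`, continuous in `x`. -/
def Nice (f : ℝ → ℝ) (a b s : ℝ) (w : ℝ → ℝ → ℝ) : Prop :=
  (∀ η : ℝ, 0 < η → ∃ C : ℝ, 0 ≤ C ∧ ∀ t ∈ Set.Ioo a b, ∀ x,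
    |w t x| ≤ C * (QQ f 0 s x / QQ f 0 t x) ^ η) ∧ ∀ t ∈ Set.Ioo a b, Continuous (w t)

section N
variable {f : ℝ → ℝ} {α a b s : ℝ}

lemma Ctx.ratio (h : Ctx f α a b s) {t : ℝ} (ht : t ∈ Set.Ioo a b) (x : ℝ) :
    1 ≤ QQ f 0 s x / QQ f 0 t x := by
  have ht0 : 0 < t := h.ha.trans ht.1
  rw [one_le_div (QQ_pos h.hf0 h.hf1 h.hfi ht0 x)]
  exact QQ_mono h.hf0 h.hfi ht0 (by linarith [ht.2, h.hbs]) x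

lemma Nice.ofTime (h : Ctx f α a b s) (φ : ℝ → ℝ) (C : ℝ) (hφ : ∀ t ∈ Set.Ioo a b, |φ t| ≤ C) :
    Nice f a b s (fun t _ => φ t) := by
  refine ⟨fun η hη => ⟨|C|, abs_nonneg _, fun t ht x => ?_⟩, fun t _ => continuous_const⟩
  have h1 := Real.one_le_rpow (h.ratio ht x) hη.le
  have h2 := (hφ t ht).trans (le_abs_self C)
  nlinarith [abs_nonneg C]

lemma Nice.const (h : Ctx f α a b s) (c : ℝ) : Nice f a b s (fun _ _ => c) :=
  Nice.ofTime h (fun _ => c) |c| (fun _ _ => le_rfl)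

lemma Nice.invTime (h : Ctx f α a b s) : Nice f a b s (fun t _ => t⁻¹) := by
  refine Nice.ofTime h (fun t => t⁻¹) a⁻¹ (fun t ht => ?_)
  have ht0 : 0 < t := h.ha.trans ht.1
  rw [abs_of_pos (by positivity)]
  exact inv_anti₀ h.ha ht.1.le

lemma Nice.add {v w : ℝ → ℝ → ℝ} (hv : Nice f a b s v) (hw : Nice f a b s w) :
    Nice f a b s (fun t x => v t x + w t x) := by
  refine ⟨fun η hη => ?_, fun t ht => (hv.2 t ht).add (hw.2 t ht)⟩
  obtain ⟨C, hC, h1⟩ := hv.1 η hη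
  obtain ⟨D, hD, h2⟩ := hw.1 η hη
  refine ⟨C + D, by positivity, fun t ht x => ?_⟩
  refine (abs_add_le _ _).trans ?_
  rw [add_mul]
  exact add_le_add (h1 t ht x) (h2 t ht x)

lemma Nice.mul (h : Ctx f α a b s) {v w : ℝ → ℝ → ℝ} (hv : Nice f a b s v) (hw : Nice f a b s w) :
    Nice f a b s (fun t x => v t x * w t x) := by
  refine ⟨fun η hη => ?_, fun t ht => (hv.2 t ht).mul (hw.2 t ht)⟩
  obtain ⟨C, hC, h1⟩ := hv.1 (η / 2) (by positivity)
  obtain ⟨D, hD, h2⟩ := hw.1 (η / 2) (by positivity)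
  refine ⟨C * D, by positivity, fun t ht x => ?_⟩
  rw [abs_mul]
  have hr := h.ratio ht x
  have h3 : (QQ f 0 s x / QQ f 0 t x) ^ η =
      (QQ f 0 s x / QQ f 0 t x) ^ (η / 2) * (QQ f 0 s x / QQ f 0 t x) ^ (η / 2) := by
    rw [← Real.rpow_add (by linarith)]; congr 1; ring
  rw [h3]
  calc |v t x| * |w t x| ≤ _ := mul_le_mul (h1 t ht x) (h2 t ht x) (abs_nonneg _)
        (mul_nonneg hC (Real.rpow_nonneg (by linarith) _))
    _ = _ := by ring

lemma Nice.neg {w : ℝ → ℝ → ℝ} (hw : Nice f a b s w) : Nice f a b s (fun t x => - w t x) := by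
  refine ⟨fun η hη => ?_, fun t ht => (hw.2 t ht).neg⟩
  obtain ⟨C, hC, h1⟩ := hw.1 η hη
  exact ⟨C, hC, fun t ht x => by rw [abs_neg]; exact h1 t ht x⟩

lemma Nice.sub {v w : ℝ → ℝ → ℝ} (hv : Nice f a b s v) (hw : Nice f a b s w) :
    Nice f a b s (fun t x => v t x - w t x) := by
  simpa [sub_eq_add_neg] using hv.add hw.neg

lemma Nice.pow (h : Ctx f α a b s) {w : ℝ → ℝ → ℝ} (hw : Nice f a b s w) (n : ℕ) :
    Nice f a b s (fun t x => w t x ^ n) := by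
  induction n with
  | zero => simpa using Nice.const h 1
  | succ n ih => simpa [pow_succ] using ih.mul h hw

lemma Nice.div_t (h : Ctx f α a b s) {w : ℝ → ℝ → ℝ} (hw : Nice f a b s w) (n : ℕ) :
    Nice f a b s (fun t x => w t x / t ^ n) := by
  simpa [div_eq_mul_inv, inv_pow] using hw.mul h ((Nice.invTime h).pow h n)

lemma Nice.mu (h : Ctx f α a b s) (j : ℕ) : Nice f a b s (fun t x => mu f j t x) := by
  refine ⟨fun η hη => ?_, fun t ht => ?_⟩
  · obtain ⟨C, hC, h1⟩ := mu_bound h.hf0 h.hf1 h.hfi j (h.ha.trans h.hab) h.hbs hη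
    exact ⟨C, hC, fun t ht x => h1 t (h.ha.trans ht.1) ht.2.le x⟩
  · rw [continuous_iff_continuousAt]
    exact fun x => (mu_hasDerivAt_x h.hf0 h.hf1 h.hfi j (h.ha.trans ht.1) x).continuousAt

/-! ### Derivatives of `α log p` -/

/-- first derivative of `α log p` -/
noncomputable def w1 (f : ℝ → ℝ) (α t x : ℝ) : ℝ := -(α * mu f 1 t x / t ^ 1)
/-- second derivative of `α log p` -/
noncomputable def w2 (f : ℝ → ℝ) (α t x : ℝ) : ℝ :=
  α * ((mu f 2 t x - mu f 1 t x ^ 2) / t ^ 2 - 1 / t ^ 1)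
/-- third derivative of `α log p` -/
noncomputable def w3 (f : ℝ → ℝ) (α t x : ℝ) : ℝ :=
  -(α * (mu f 3 t x - 3 * mu f 1 t x * mu f 2 t x + 2 * mu f 1 t x ^ 3) / t ^ 3)
/-- fourth derivative of `α log p` -/
noncomputable def w4 (f : ℝ → ℝ) (α t x : ℝ) : ℝ :=
  α * (mu f 4 t x - 4 * mu f 3 t x * mu f 1 t x - 3 * mu f 2 t x ^ 2
    + 12 * mu f 2 t x * mu f 1 t x ^ 2 - 6 * mu f 1 t x ^ 4) / t ^ 4
/-- fifth derivative of `α log p` -/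
noncomputable def w5 (f : ℝ → ℝ) (α t x : ℝ) : ℝ :=
  -(α * (mu f 5 t x - 5 * mu f 4 t x * mu f 1 t x - 10 * mu f 3 t x * mu f 2 t x
    + 20 * mu f 3 t x * mu f 1 t x ^ 2 + 30 * mu f 2 t x ^ 2 * mu f 1 t x
    - 60 * mu f 2 t x * mu f 1 t x ^ 3 + 24 * mu f 1 t x ^ 5) / t ^ 5)

lemma mu_zero (h : Ctx f α a b s) {t : ℝ} (ht : t ∈ Set.Ioo a b) (x : ℝ) : _root_.mu f 0 t x = 1 := by
  rw [_root_.mu, div_self (QQ_pos h.hf0 h.hf1 h.hfi (h.ha.trans ht.1) x).ne']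

lemma nice_w1 (h : Ctx f α a b s) : Nice f a b s (fun t x => w1 f α t x) := by
  unfold w1
  repeat' first | exact Nice.mu h _ | exact Nice.const h _ | apply Nice.neg | apply Nice.div_t h | apply Nice.sub | apply Nice.add | apply Nice.pow h | apply Nice.mul h
lemma nice_w2 (h : Ctx f α a b s) : Nice f a b s (fun t x => w2 f α t x) := by
  unfold w2
  repeat' first | exact Nice.mu h _ | exact Nice.const h _ | apply Nice.neg | apply Nice.div_t h | apply Nice.sub | apply Nice.add | apply Nice.pow h | apply Nice.mul h
lemma nice_w3 (h : Ctx f α a b s) : Nice f a b s (fun t x => w3 f α t x) := by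
  unfold w3
  repeat' first | exact Nice.mu h _ | exact Nice.const h _ | apply Nice.neg | apply Nice.div_t h | apply Nice.sub | apply Nice.add | apply Nice.pow h | apply Nice.mul h
lemma nice_w4 (h : Ctx f α a b s) : Nice f a b s (fun t x => w4 f α t x) := by
  unfold w4
  repeat' first | exact Nice.mu h _ | exact Nice.const h _ | apply Nice.neg | apply Nice.div_t h | apply Nice.sub | apply Nice.add | apply Nice.pow h | apply Nice.mul h
lemma nice_w5 (h : Ctx f α a b s) : Nice f a b s (fun t x => w5 f α t x) := by
  unfold w5
  repeat' first | exact Nice.mu h _ | exact Nice.const h _ | apply Nice.neg | apply Nice.div_t h | apply Nice.sub | apply Nice.add | apply Nice.pow h | apply Nice.mul h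

section derivs

lemma w1_dx (h : Ctx f α a b s) {t : ℝ} (ht : t ∈ Set.Ioo a b) (x : ℝ) : HasDerivAt (fun x => w1 f α t x) (w2 f α t x) x := by
  have ht0 : 0 < t := h.ha.trans ht.1
  have m0 := mu_zero h ht x
  have m1 := mu_hasDerivAt_x h.hf0 h.hf1 h.hfi 1 ht0 x
  have := ((m1.const_mul α).div_const (t ^ 1)).fun_neg
  refine this.congr_deriv ?_
  simp only [w2, Nat.sub_self, m0, Nat.reduceAdd]
  push_cast
  field_simp
  ring

lemma w2_dx (h : Ctx f α a b s) {t : ℝ} (ht : t ∈ Set.Ioo a b) (x : ℝ) : HasDerivAt (fun x => w2 f α t x) (w3 f α t x) x := by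
  have ht0 : 0 < t := h.ha.trans ht.1
  have m0 := mu_zero h ht x
  have m1 := mu_hasDerivAt_x h.hf0 h.hf1 h.hfi 1 ht0 x
  have m2 := mu_hasDerivAt_x h.hf0 h.hf1 h.hfi 2 ht0 x
  have := (((m2.fun_sub (m1.fun_pow 2)).div_const (t ^ 2)).sub_const (1 / t ^ 1)).const_mul α
  refine this.congr_deriv ?_
  simp only [w3, Nat.sub_self, m0, Nat.reduceAdd, Nat.reduceSub]
  push_cast
  field_simp
  ring

lemma w3_dx (h : Ctx f α a b s) {t : ℝ} (ht : t ∈ Set.Ioo a b) (x : ℝ) : HasDerivAt (fun x => w3 f α t x) (w4 f α t x) x := by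
  have ht0 : 0 < t := h.ha.trans ht.1
  have m0 := mu_zero h ht x
  have m1 := mu_hasDerivAt_x h.hf0 h.hf1 h.hfi 1 ht0 x
  have m2 := mu_hasDerivAt_x h.hf0 h.hf1 h.hfi 2 ht0 x
  have m3 := mu_hasDerivAt_x h.hf0 h.hf1 h.hfi 3 ht0 x
  have := ((((m3.fun_sub ((m1.const_mul 3).fun_mul m2)).fun_add ((m1.fun_pow 3).const_mul 2)).const_mul α).div_const (t ^ 3)).fun_neg
  refine this.congr_deriv ?_
  simp only [w4, Nat.sub_self, m0, Nat.reduceAdd, Nat.reduceSub]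
  push_cast
  field_simp
  ring

lemma w4_dx (h : Ctx f α a b s) {t : ℝ} (ht : t ∈ Set.Ioo a b) (x : ℝ) : HasDerivAt (fun x => w4 f α t x) (w5 f α t x) x := by
  have ht0 : 0 < t := h.ha.trans ht.1
  have m0 := mu_zero h ht x
  have m1 := mu_hasDerivAt_x h.hf0 h.hf1 h.hfi 1 ht0 x
  have m2 := mu_hasDerivAt_x h.hf0 h.hf1 h.hfi 2 ht0 x
  have m3 := mu_hasDerivAt_x h.hf0 h.hf1 h.hfi 3 ht0 x
  have m4 := mu_hasDerivAt_x h.hf0 h.hf1 h.hfi 4 ht0 x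
  have := (((((m4.fun_sub ((m3.const_mul 4).fun_mul m1)).fun_sub ((m2.fun_pow 2).const_mul 3)).fun_add
    ((m2.const_mul 12).fun_mul (m1.fun_pow 2))).fun_sub ((m1.fun_pow 4).const_mul 6)).const_mul α).div_const (t ^ 4)
  refine this.congr_deriv ?_
  simp only [w5, Nat.sub_self, m0, Nat.reduceAdd, Nat.reduceSub]
  push_cast
  field_simp
  ring

lemma w1_dt (h : Ctx f α a b s) {t : ℝ} (ht : t ∈ Set.Ioo a b) (x : ℝ) : HasDerivAt (fun t => w1 f α t x)
    (1 / 2 * (w3 f α t x + 2 * α⁻¹ * (w1 f α t x * w2 f α t x))) t := by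
  have ht0 : 0 < t := h.ha.trans ht.1
  have hα : 0 < α := by linarith [h.hα]
  have m1 := mu_hasDerivAt_t h.hf0 h.hf1 h.hfi 1 ht0 x
  have := ((m1.const_mul α).fun_div (hasDerivAt_pow 1 t) (by positivity)).fun_neg
  refine this.congr_deriv ?_
  simp only [w1, w2, w3, Nat.reduceAdd, Nat.reduceSub]
  push_cast
  field_simp
  ring

lemma w2_dt (h : Ctx f α a b s) {t : ℝ} (ht : t ∈ Set.Ioo a b) (x : ℝ) : HasDerivAt (fun t => w2 f α t x)
    (1 / 2 * (w4 f α t x + 2 * α⁻¹ * (w2 f α t x ^ 2 + w1 f α t x * w3 f α t x))) t := by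
  have ht0 : 0 < t := h.ha.trans ht.1
  have hα : 0 < α := by linarith [h.hα]
  have m1 := mu_hasDerivAt_t h.hf0 h.hf1 h.hfi 1 ht0 x
  have m2 := mu_hasDerivAt_t h.hf0 h.hf1 h.hfi 2 ht0 x
  have := (((m2.fun_sub (m1.fun_pow 2)).fun_div (hasDerivAt_pow 2 t) (by positivity)).fun_sub
    ((hasDerivAt_const t (1:ℝ)).fun_div (hasDerivAt_pow 1 t) (by positivity))).const_mul α
  refine this.congr_deriv ?_
  simp only [w1, w2, w3, w4, Nat.reduceAdd, Nat.reduceSub]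
  push_cast
  field_simp
  ring

lemma w3_dt (h : Ctx f α a b s) {t : ℝ} (ht : t ∈ Set.Ioo a b) (x : ℝ) : HasDerivAt (fun t => w3 f α t x)
    (1 / 2 * (w5 f α t x + 2 * α⁻¹ * (3 * (w2 f α t x * w3 f α t x) + w1 f α t x * w4 f α t x))) t := by
  have ht0 : 0 < t := h.ha.trans ht.1
  have hα : 0 < α := by linarith [h.hα]
  have m1 := mu_hasDerivAt_t h.hf0 h.hf1 h.hfi 1 ht0 x
  have m2 := mu_hasDerivAt_t h.hf0 h.hf1 h.hfi 2 ht0 x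
  have m3 := mu_hasDerivAt_t h.hf0 h.hf1 h.hfi 3 ht0 x
  have := ((((m3.fun_sub ((m1.const_mul 3).fun_mul m2)).fun_add ((m1.fun_pow 3).const_mul 2)).const_mul α).fun_div
    (hasDerivAt_pow 3 t) (by positivity)).fun_neg
  refine this.congr_deriv ?_
  simp only [w1, w2, w3, w4, w5, Nat.reduceAdd, Nat.reduceSub]
  push_cast
  field_simp
  ring

lemma heatP_eq (_h : Ctx f α a b s) (x τ : ℝ) : heatP f τ x = (Real.sqrt (2 * Real.pi * τ))⁻¹ * QQ f 0 τ x := by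
  unfold heatP QQ
  rw [← integral_const_mul]
  congr 1; ext y; ring

lemma heatP_pos (h : Ctx f α a b s) {t : ℝ} (ht : t ∈ Set.Ioo a b) (x : ℝ) : 0 < heatP f t x := by
  have ht0 : 0 < t := h.ha.trans ht.1
  rw [heatP_eq h]
  have := QQ_pos h.hf0 h.hf1 h.hfi ht0 x
  positivity

lemma heatP_dx (h : Ctx f α a b s) {t : ℝ} (ht : t ∈ Set.Ioo a b) (x : ℝ) : HasDerivAt (fun x => heatP f t x) (α⁻¹ * w1 f α t x * heatP f t x) x := by
  have ht0 : 0 < t := h.ha.trans ht.1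
  have hα : 0 < α := by linarith [h.hα]
  have hp := QQ_pos h.hf0 h.hf1 h.hfi ht0 x
  have e : (fun x => heatP f t x) = fun x => (Real.sqrt (2 * Real.pi * t))⁻¹ * QQ f 0 t x := by
    ext x; exact heatP_eq h x t
  rw [e]
  refine ((QQ_hasDerivAt_x h.hfi 0 ht0 x).const_mul _).congr_deriv ?_
  rw [heatP_eq h]
  simp only [w1, _root_.mu, Nat.cast_zero, zero_add]
  field_simp
  ring

lemma heatP_dt (h : Ctx f α a b s) {t : ℝ} (ht : t ∈ Set.Ioo a b) (x : ℝ) : HasDerivAt (fun t => heatP f t x)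
    (1 / 2 * α⁻¹ * (w2 f α t x + α⁻¹ * w1 f α t x ^ 2) * heatP f t x) t := by
  have ht0 : 0 < t := h.ha.trans ht.1
  have hα : 0 < α := by linarith [h.hα]
  have hp := QQ_pos h.hf0 h.hf1 h.hfi ht0 x
  have e : (fun t => heatP f t x) = fun t => (Real.sqrt (2 * Real.pi * t))⁻¹ * QQ f 0 t x := by
    ext τ; exact heatP_eq h x τ
  rw [e]
  have hpt : 0 < 2 * Real.pi * t := by positivity
  have hs := (((hasDerivAt_id t).const_mul (2 * Real.pi)).sqrt hpt.ne').fun_inv (Real.sqrt_pos.mpr hpt).ne'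
  refine (hs.fun_mul (QQ_hasDerivAt_t h.hfi 0 ht0 x)).congr_deriv ?_
  rw [heatP_eq h]
  simp only [w1, w2, _root_.mu, zero_add, id, mul_one]
  have hsq : Real.sqrt (2 * Real.pi * t) ^ 2 = 2 * Real.pi * t := Real.sq_sqrt hpt.le
  have hs0 := (Real.sqrt_pos.mpr hpt)
  set S := Real.sqrt (2 * Real.pi * t) with hS
  have hpi : 2 * Real.pi = S ^ 2 / t := by rw [hsq]; field_simp
  rw [hpi]
  field_simp
  ring

lemma pa_dx (h : Ctx f α a b s) {t : ℝ} (ht : t ∈ Set.Ioo a b) (x : ℝ) : HasDerivAt (fun x => heatP f t x ^ α) (w1 f α t x * heatP f t x ^ α) x := by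
  have hα : 0 < α := by linarith [h.hα]
  have hp := heatP_pos h ht x
  refine ((heatP_dx h ht x).rpow_const (Or.inl hp.ne')).congr_deriv ?_
  rw [Real.rpow_sub_one hp.ne']
  field_simp

lemma pa_dt (h : Ctx f α a b s) {t : ℝ} (ht : t ∈ Set.Ioo a b) (x : ℝ) : HasDerivAt (fun t => heatP f t x ^ α)
    (1 / 2 * (w2 f α t x + α⁻¹ * w1 f α t x ^ 2) * heatP f t x ^ α) t := by
  have hα : 0 < α := by linarith [h.hα]
  have hp := heatP_pos h ht x
  refine ((heatP_dt h ht x).rpow_const (Or.inl hp.ne')).congr_deriv ?_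
  rw [Real.rpow_sub_one hp.ne']
  field_simp

end derivs
end N

/-! ### Differentiation under the integral and integration by parts -/

section I
variable {f : ℝ → ℝ} {α a b s : ℝ}

lemma Nice.dom (h : Ctx f α a b s) {w : ℝ → ℝ → ℝ} (hw : Nice f a b s w) :
    ∃ C : ℝ, 0 ≤ C ∧ ∀ t ∈ Set.Ioo a b, ∀ x,
      |w t x * heatP f t x ^ α| ≤ C * QQ f 0 s x ^ α := by
  obtain ⟨C, hC, h1⟩ := hw.1 (1 / 2) (by norm_num)
  have hα : 0 < α := by linarith [h.hα]
  refine ⟨C * ((Real.sqrt (2 * Real.pi * a))⁻¹) ^ α, by positivity, fun t ht x => ?_⟩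
  have ht0 : 0 < t := h.ha.trans ht.1
  have ha := h.ha
  have hs0 : 0 < s := by linarith [h.hbs, h.hab]
  have hq := QQ_pos h.hf0 h.hf1 h.hfi ht0 x
  have hqs := QQ_pos h.hf0 h.hf1 h.hfi hs0 x
  have hr := h.ratio ht x
  have hp := heatP_pos h ht x
  rw [abs_mul, abs_of_pos (Real.rpow_pos_of_pos hp α), heatP_eq h,
    Real.mul_rpow (by positivity) hq.le]
  have e1 : ((Real.sqrt (2 * Real.pi * t))⁻¹) ^ α ≤ ((Real.sqrt (2 * Real.pi * a))⁻¹) ^ α := by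
    apply Real.rpow_le_rpow (by positivity) _ hα.le
    apply inv_anti₀ (by positivity)
    apply Real.sqrt_le_sqrt
    have := ht.1.le
    gcongr
  have e2 : (QQ f 0 s x / QQ f 0 t x) ^ (1 / 2 : ℝ) ≤ QQ f 0 s x ^ α / QQ f 0 t x ^ α := by
    rw [← Real.div_rpow hqs.le hq.le]
    exact Real.rpow_le_rpow_of_exponent_le hr h.hα
  have e3 := (h1 t ht x).trans (mul_le_mul_of_nonneg_left e2 hC)
  have hqa := Real.rpow_pos_of_pos hq α
  have hqsa := Real.rpow_pos_of_pos hqs α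
  calc |w t x| * (((Real.sqrt (2 * Real.pi * t))⁻¹) ^ α * QQ f 0 t x ^ α)
      ≤ (C * (QQ f 0 s x ^ α / QQ f 0 t x ^ α)) *
        (((Real.sqrt (2 * Real.pi * a))⁻¹) ^ α * QQ f 0 t x ^ α) := by gcongr
    _ = _ := by field_simp

lemma pa_cont (h : Ctx f α a b s) {t : ℝ} (ht : t ∈ Set.Ioo a b) :
    Continuous fun x => heatP f t x ^ α := by
  rw [continuous_iff_continuousAt]
  exact fun x => (pa_dx h ht x).continuousAt

lemma Nice.integrable (h : Ctx f α a b s) {w : ℝ → ℝ → ℝ} (hw : Nice f a b s w)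
    {t : ℝ} (ht : t ∈ Set.Ioo a b) : Integrable (fun x => w t x * heatP f t x ^ α) := by
  obtain ⟨C, hC, h1⟩ := hw.dom h
  refine (h.hintg.const_mul C).mono' ?_ (Eventually.of_forall fun x => h1 t ht x)
  exact ((hw.2 t ht).mul (pa_cont h ht)).aestronglyMeasurable

lemma Nice.ibp (h : Ctx f α a b s) {w w' : ℝ → ℝ → ℝ} (hw : Nice f a b s w) (hw' : Nice f a b s w')
    {t : ℝ} (ht : t ∈ Set.Ioo a b) (hd : ∀ x, HasDerivAt (fun x => w t x) (w' t x) x) :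
    ∫ x, (w' t x + w1 f α t x * w t x) * heatP f t x ^ α = 0 := by
  apply integral_eq_zero_of_hasDerivAt_of_integrable (f := fun x => w t x * heatP f t x ^ α)
  · intro x
    refine ((hd x).fun_mul (pa_dx h ht x)).congr_deriv ?_
    ring
  · exact (hw'.add ((nice_w1 h).mul h hw)).integrable h ht
  · exact hw.integrable h ht

lemma Nice.dt (h : Ctx f α a b s) {w w' : ℝ → ℝ → ℝ} (hw : Nice f a b s w) (hw' : Nice f a b s w')
    (hd : ∀ t ∈ Set.Ioo a b, ∀ x, HasDerivAt (fun t => w t x) (w' t x) t)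
    {t : ℝ} (ht : t ∈ Set.Ioo a b) :
    HasDerivAt (fun t => ∫ x, w t x * heatP f t x ^ α)
      (∫ x, (w' t x + 1 / 2 * (w2 f α t x + α⁻¹ * w1 f α t x ^ 2) * w t x) * heatP f t x ^ α) t := by
  have hn : Nice f a b s (fun t x => w' t x + 1 / 2 * (w2 f α t x + α⁻¹ * w1 f α t x ^ 2) * w t x) :=
    hw'.add (((Nice.const h (1 / 2)).mul h ((nice_w2 h).add
      ((Nice.const h α⁻¹).mul h ((nice_w1 h).pow h 2)))).mul h hw)
  obtain ⟨C, hC, h1⟩ := hn.dom h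
  have hmem : Set.Ioo a b ∈ nhds t := Ioo_mem_nhds ht.1 ht.2
  refine (hasDerivAt_integral_of_dominated_loc_of_deriv_le (μ := volume) (𝕜 := ℝ)
    (F := fun t x => w t x * heatP f t x ^ α)
    (F' := fun t x => (w' t x + 1 / 2 * (w2 f α t x + α⁻¹ * w1 f α t x ^ 2) * w t x) * heatP f t x ^ α)
    (bound := fun x => C * QQ f 0 s x ^ α)
    (x₀ := t) (s := Set.Ioo a b) hmem ?_ ?_ ?_ ?_ ?_ ?_).2
  · filter_upwards [hmem] with τ hτ
    exact (hw.integrable h hτ).aestronglyMeasurable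
  · exact hw.integrable h ht
  · exact (hn.integrable h ht).aestronglyMeasurable
  · exact Eventually.of_forall fun x τ hτ => h1 τ hτ x
  · exact h.hintg.const_mul C
  · refine Eventually.of_forall fun x τ hτ => ?_
    refine ((hd τ hτ x).fun_mul (pa_dt h hτ x)).congr_deriv ?_
    ring

/-- monomials in the derivatives of `α log p` -/
noncomputable def mon (f : ℝ → ℝ) (α : ℝ) (i j k l m : ℕ) (t x : ℝ) : ℝ :=
  w1 f α t x ^ i * w2 f α t x ^ j * w3 f α t x ^ k * w4 f α t x ^ l * w5 f α t x ^ m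

/-- moments -/
noncomputable def mom (f : ℝ → ℝ) (α : ℝ) (i j k l m : ℕ) (t : ℝ) : ℝ :=
  ∫ x, mon f α i j k l m t x * heatP f t x ^ α

lemma nice_mon (h : Ctx f α a b s) (i j k l m : ℕ) :
    Nice f a b s (fun t x => mon f α i j k l m t x) := by
  unfold mon
  exact (((((nice_w1 h).pow h i).mul h ((nice_w2 h).pow h j)).mul h ((nice_w3 h).pow h k)).mul h
    ((nice_w4 h).pow h l)).mul h ((nice_w5 h).pow h m)

/-- `w` is nice with integral `v` at time `t`. -/
def HasJ (f : ℝ → ℝ) (α a b s t : ℝ) (w : ℝ → ℝ → ℝ) (v : ℝ) : Prop :=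
  Nice f a b s w ∧ ∫ x, w t x * heatP f t x ^ α = v

lemma HasJ.mon (h : Ctx f α a b s) (t : ℝ) (i j k l m : ℕ) :
    HasJ f α a b s t (fun t x => mon f α i j k l m t x) (mom f α i j k l m t) :=
  ⟨nice_mon h i j k l m, rfl⟩

lemma HasJ.add (h : Ctx f α a b s) {t : ℝ} (ht : t ∈ Set.Ioo a b) {w w' : ℝ → ℝ → ℝ} {v v' : ℝ}
    (hw : HasJ f α a b s t w v) (hw' : HasJ f α a b s t w' v') :
    HasJ f α a b s t (fun t x => w t x + w' t x) (v + v') := by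
  refine ⟨hw.1.add hw'.1, ?_⟩
  rw [← hw.2, ← hw'.2, ← integral_add (hw.1.integrable h ht) (hw'.1.integrable h ht)]
  congr 1; ext x; ring

lemma HasJ.smul (h : Ctx f α a b s) {t : ℝ} (c : ℝ) {w : ℝ → ℝ → ℝ} {v : ℝ}
    (hw : HasJ f α a b s t w v) :
    HasJ f α a b s t (fun t x => c * w t x) (c * v) := by
  refine ⟨(Nice.const h c).mul h hw.1, ?_⟩
  rw [← hw.2, ← integral_const_mul]
  congr 1; ext x; ring

lemma HasJ.sum (h : Ctx f α a b s) {t : ℝ} (ht : t ∈ Set.Ioo a b) {ι : Type} (S : Finset ι)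
    {w : ι → ℝ → ℝ → ℝ} {v : ι → ℝ} (hw : ∀ i, HasJ f α a b s t (w i) (v i)) :
    HasJ f α a b s t (fun t x => ∑ i ∈ S, w i t x) (∑ i ∈ S, v i) := by
  induction S using Finset.induction_on with
  | empty => simpa using (hasJ0 h)
  | insert i S hi ih =>
    simp only [Finset.sum_insert hi]
    exact (hw i).add h ht ih
where
  hasJ0 (h : Ctx f α a b s) {t : ℝ} : HasJ f α a b s t (fun _ _ => 0) 0 := by
    refine ⟨Nice.const h 0, by simp⟩

/-- Integration by parts for moments. -/
lemma mom_ibp (h : Ctx f α a b s) {t : ℝ} (ht : t ∈ Set.Ioo a b) (i j k l : ℕ) :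
    i * mom f α (i - 1) (j + 1) k l 0 t + j * mom f α i (j - 1) (k + 1) l 0 t
      + k * mom f α i j (k - 1) (l + 1) 0 t + l * mom f α i j k (l - 1) 1 t
      + mom f α (i + 1) j k l 0 t = 0 := by
  have hJ := ((((((HasJ.mon h t (i - 1) (j + 1) k l 0).smul h (i:ℝ)).add h ht
    ((HasJ.mon h t i (j - 1) (k + 1) l 0).smul h (j:ℝ))).add h ht
    ((HasJ.mon h t i j (k - 1) (l + 1) 0).smul h (k:ℝ))).add h ht
    ((HasJ.mon h t i j k (l - 1) 1).smul h (l:ℝ))))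
  have hib := Nice.ibp h (nice_mon h i j k l 0) hJ.1 ht (fun x => by
    have := ((((w1_dx h ht x).fun_pow i).fun_mul ((w2_dx h ht x).fun_pow j)).fun_mul ((w3_dx h ht x).fun_pow k)).fun_mul
      ((w4_dx h ht x).fun_pow l)
    have e : (fun x => _root_.mon f α i j k l 0 t x) = fun x =>
      w1 f α t x ^ i * w2 f α t x ^ j * w3 f α t x ^ k * w4 f α t x ^ l := by
      ext x; simp [_root_.mon]
    rw [e]
    refine this.congr_deriv ?_
    simp only [_root_.mon]
    ring)
  have hJ2 := hJ.add h ht (HasJ.mon h t (i + 1) j k l 0)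
  rw [← hJ2.2, ← hib]
  congr 1; ext x
  simp only [_root_.mon]
  ring

/-- Time derivative for moments. -/
lemma mom_dt (h : Ctx f α a b s) {t : ℝ} (ht : t ∈ Set.Ioo a b) (i j k : ℕ) :
    HasDerivAt (fun t => mom f α i j k 0 0 t)
      (1 / 2 * (i * (mom f α (i - 1) j (k + 1) 0 0 t + 2 * α⁻¹ * mom f α i (j + 1) k 0 0 t)
      + j * (mom f α i (j - 1) k 1 0 t + 2 * α⁻¹ * (mom f α i (j + 1) k 0 0 t
          + mom f α (i + 1) (j - 1) (k + 1) 0 0 t))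
      + k * (mom f α i j (k - 1) 0 1 t + 2 * α⁻¹ * (3 * mom f α i (j + 1) k 0 0 t
          + mom f α (i + 1) j (k - 1) 1 0 t))
      + mom f α i (j + 1) k 0 0 t + α⁻¹ * mom f α (i + 2) j k 0 0 t)) t := by
  have H := HasJ.mon h t
  have hJ := ((((H (i - 1) j (k + 1) 0 0).add h ht ((H i (j + 1) k 0 0).smul h (2 * α⁻¹))).smul h (i:ℝ)).add h ht
    (((H i (j - 1) k 1 0).add h ht (((H i (j + 1) k 0 0).add h ht
      (H (i + 1) (j - 1) (k + 1) 0 0)).smul h (2 * α⁻¹))).smul h (j:ℝ))).add h ht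
    (((H i j (k - 1) 0 1).add h ht ((((H i (j + 1) k 0 0).smul h 3).add h ht
      (H (i + 1) j (k - 1) 1 0)).smul h (2 * α⁻¹))).smul h (k:ℝ))
  have hJh := hJ.smul h (1 / 2)
  have hdt := Nice.dt h (nice_mon h i j k 0 0) hJh.1 (fun t ht x => by
    have := ((((w1_dt h ht x).fun_pow i).fun_mul ((w2_dt h ht x).fun_pow j)).fun_mul ((w3_dt h ht x).fun_pow k))
    have e : (fun t => _root_.mon f α i j k 0 0 t x) = fun t =>
      w1 f α t x ^ i * w2 f α t x ^ j * w3 f α t x ^ k := by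
      ext x; simp [_root_.mon]
    rw [e]
    refine this.congr_deriv ?_
    have pi : ∀ (z : ℝ) (n : ℕ), (n:ℝ) * z ^ n = n * z ^ (n - 1) * z := by
      intro z n
      cases n with
      | zero => simp
      | succ n => simp [pow_succ]; ring
    have p1 := pi (w1 f α t x) i
    have p2 := pi (w2 f α t x) j
    have p3 := pi (w3 f α t x) k
    simp only [_root_.mon, pow_zero, mul_one, pow_succ]
    linear_combination (-(α⁻¹ * w2 f α t x * w2 f α t x ^ j * w3 f α t x ^ k)) * p1
      - (α⁻¹ * w1 f α t x ^ i * w2 f α t x * w3 f α t x ^ k) * p2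
      - (3 * α⁻¹ * w1 f α t x ^ i * w2 f α t x * w2 f α t x ^ j) * p3) ht
  refine hdt.congr_deriv ?_
  have hJ2 := ((hJ.add h ht (H i (j + 1) k 0 0)).add h ht ((H (i + 2) j k 0 0).smul h α⁻¹)).smul h (1 / 2)
  rw [← hJ2.2]
  congr 1; ext x
  simp only [_root_.mon]
  ring

lemma mom_zero_pos (h : Ctx f α a b s) {t : ℝ} (ht : t ∈ Set.Ioo a b) :
    0 < mom f α 0 0 0 0 0 t := by
  unfold mom
  rw [integral_pos_iff_support_of_nonneg _ ((nice_mon h 0 0 0 0 0).integrable h ht)]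
  · have : Function.support (fun x => mon f α 0 0 0 0 0 t x * heatP f t x ^ α) = Set.univ := by
      ext x
      simp [_root_.mon, (Real.rpow_pos_of_pos (heatP_pos h ht x) α).ne']
    rw [this]; simp
  · intro x
    have := Real.rpow_pos_of_pos (heatP_pos h ht x) α
    simp [_root_.mon, this.le]

end I

/-! ### The algebraic certificate -/

set_option linter.unusedVariables false

/-- The quadratic form of the normalised moments. -/
noncomputable def QF (X1 X2 X3 X4 X5 X6 X7 Y1 Y2 Y3 Y4 A B c a0 a1 a2 a3 a4 a5 a6 a7 : ℝ) : ℝ :=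
      a0*a0*((1)*(X1))
      + a0*a1*((-1)*(X2) + (-1)*(X3))
      + a0*a2*((-4)*(X2) + (2/3)*(X4) + (2/3)*(X5))
      + a0*a3*((-2)*(X3) + (13/3)*(X5) + (1)*(X6) + (4/3)*(X4))
      + a0*a4*((14)*(X6) + (12)*(X5) + (-2/7)*(X7))
      + a0*a5*((8)*(Y3) + (2)*(Y2) + (-2/5)*(Y4))
      + a0*a6*((-2)*(Y1) + (1)*(Y2) + (1)*(Y3))
      + a0*a7*((2)*(B) + (-2/3)*(A))
      + a1*a1*((1)*(X3))
      + a1*a2*((-2/3)*(X4) + (-2/3)*(X5))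
      + a1*a3*((-3)*(X5) + (-1)*(X6))
      + a1*a4*((-10)*(X6) + (2/7)*(X7))
      + a1*a5*((-6)*(Y3) + (2/5)*(Y4))
      + a1*a6*((-1)*(Y2) + (-1)*(Y3))
      + a1*a7*((-2)*(B) + (2/3)*(A))
      + a2*a2*((1)*(X4))
      + a2*a3*((2)*(X5))
      + a2*a4*((2)*(X6))
      + a2*a5*((2)*(Y3))
      + a2*a6*((2)*(Y2))
      + a2*a7*((2)*(B))
      + a3*a3*((1)*(X6))
      + a3*a4*((-2/7)*(X7))
      + a3*a5*((-2/5)*(Y4))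
      + a3*a6*((2)*(Y3))
      + a3*a7*((-2/3)*(A))
      + a4*a4*((1)*(X7))
      + a4*a5*((2)*(Y4))
      + a4*a6*((-2/5)*(Y4))
      + a4*a7*((2)*(A))
      + a5*a5*((1)*(A))
      + a5*a6*((-2/3)*(A))
      + a5*a7*((2)*(c))
      + a6*a6*((1)*(B))
      + a6*a7*((-2)*(c))
      + a7*a7*((1)*(1))

/-- coefficient of `s^0` -/
noncomputable def TT0 (X1 X2 X3 X4 X5 X6 X7 Y1 Y2 Y3 Y4 A B c : ℝ) : ℝ :=
  (12)*(X4)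
  + (-32)*(X2)
  + (32)*(X5)
  + (8)*(X1)
  + (-16)*(X3)
  + (12)*(X6)
  + (-1/7)*(X7)
  + (16)*(Y2*c)
  + (-16)*(Y1*c)
  + (24)*(Y3*c)
  + (-4/5)*(Y4*c)
  + (-12)*(B*B)
  + (2)*(A*B)
  + (2)*(B*A)
  + (-1/3)*(A*A)
  + (24)*(B*c^2)
  + (-4)*(A*c^2)
  + (-6)*(c^4)

/-- coefficient of `s^1` -/
noncomputable def TT1 (X1 X2 X3 X4 X5 X6 X7 Y1 Y2 Y3 Y4 A B c : ℝ) : ℝ :=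
  (-16)*(X5)
  + (20)*(X4)
  + (-64)*(X2)
  + (16)*(X3)
  + (-24)*(X6)
  + (3/7)*(X7)
  + (-48)*(Y3*c)
  + (12/5)*(Y4*c)
  + (16)*(Y1*c)
  + (-4)*(A*B)
  + (1)*(A*A)
  + (-4)*(B*A)
  + (12)*(B*B)
  + (12)*(A*c^2)
  + (-48)*(B*c^2)
  + (18)*(c^4)

/-- coefficient of `s^2` -/
noncomputable def TT2 (X1 X2 X3 X4 X5 X6 X7 Y1 Y2 Y3 Y4 A B c : ℝ) : ℝ :=
  (-16)*(X5)
  + (16)*(X4)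
  + (-3/7)*(X7)
  + (12)*(X6)
  + (-12/5)*(Y4*c)
  + (-16)*(Y2*c)
  + (24)*(Y3*c)
  + (-1)*(A*A)
  + (2)*(A*B)
  + (2)*(B*A)
  + (-12)*(A*c^2)
  + (24)*(B*c^2)
  + (-18)*(c^4)

/-- coefficient of `s^3` -/
noncomputable def TT3 (X1 X2 X3 X4 X5 X6 X7 Y1 Y2 Y3 Y4 A B c : ℝ) : ℝ :=
  (1/7)*(X7)
  + (4/5)*(Y4*c)
  + (1/3)*(A*A)
  + (4)*(A*c^2)
  + (6)*(c^4)

section cert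
variable {X1 X2 X3 X4 X5 X6 X7 Y1 Y2 Y3 Y4 A B c : ℝ}

lemma cert0 (hq : ∀ a0 a1 a2 a3 a4 a5 a6 a7, 0 ≤ QF X1 X2 X3 X4 X5 X6 X7 Y1 Y2 Y3 Y4 A B c a0 a1 a2 a3 a4 a5 a6 a7) :
    0 ≤ TT0 X1 X2 X3 X4 X5 X6 X7 Y1 Y2 Y3 Y4 A B c + 71/125 * TT1 X1 X2 X3 X4 X5 X6 X7 Y1 Y2 Y3 Y4 A B c + 5041/15625 * TT2 X1 X2 X3 X4 X5 X6 X7 Y1 Y2 Y3 Y4 A B c + 357911/1953125 * TT3 X1 X2 X3 X4 X5 X6 X7 Y1 Y2 Y3 Y4 A B c := by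
  have h0 := hq (32768000000000) (63282425222912) (54171841694272) (45637798750304) (3249700861889)
    (6324845330500*c) (14155776000000*c)
    (7830937686418*c^2+(1791210627514)*A+(-23657191375000)*B)
  have h1 := hq (0) (516324260058025262149376) (-7542817207790411537344) (715790270490548428797792) (96399782072955783787497)
    (196937737290853934326500*c) (238499014873858048000000*c)
    (41559904038943026543714*c^2+(-29767846070859315821878)*A+(523540610049047729625000)*B)
  have h2 := hq (0) (0) (2530286354811611671551677779158400) (-1333358012239327722321099259808480) (-246837185530175746784988218181805)
    (2907629798977055567058664156710284*c) (4943397519519613025528412880000000*c)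
    (2032641849160192821686033151586006*c^2+(-72744523348287996087310614496562)*A+(-2174026624418635847325390613125000)*B)
  have h3 := hq (0) (0) (0) (41242079207568924479077810491501424124204960) (4385997443962739919562774326906414106274735)
    (-97176300416613374611905749640813775720383748*c) (-156560253888004084887460783056176913760000000*c)
    (-59386538471687277838547071328525112570494642*c^2+(5951940126579496825922395469351817820916134)*A+(8125071407624672604323141793676728554375000)*B)
  have h4 := hq (0) (0) (0) (0) (682770167187008195155621302736969719308536094415)
    (-82949810193860374423671295076425334365611028164*c) (-145786451712704165145185362428293088390825702400*c)
    (-62748050416145759031483342202738979694257419890*c^2+(3550130121727478900985423637244879822027024390)*A+(52520348926567576657014591475668907313064354520)*B)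
  have h5 := hq (0) (0) (0) (0) (0)
    (5362140798871077305987752804223009702032593817333580279193*c) (9633728148440702157385454476903995085792093033686812500000*c)
    (4385821781630040493231854006712938048466629573029596365344*c^2+(-265315690249491775353492135915563933617549026436590801323)*A+(501909044209467486919265346755002355581996335286066406250)*B)
  have h6 := hq (0) (0) (0) (0) (0)
    (0*c) (558002300421458612072436057697924364616813879438429862567006500*c)
    (519713955079349339839179485402514335529919094984566847739737902*c^2+(7175834142305192831117388766247654876063967539334376501635261)*A+(-15062030460226604419153222828621116024902125346323647786847855)*B)
  have h7 := hq (0) (0) (0) (0) (0)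
    (0*c) (0*c)
    (1766208525042111084216511409580121973944469135221042443845254530305163362*c^2+(2582783303711657702135951115327209115560839521974243764751951143219881)*A+(-97117214809030407505832361231778096324739421590970180737986977477265625)*B)
  have h8 := hq (0) (0) (0) (0) (0)
    (0*c) (0*c)
    (0*c^2+(367300991477535181253286101429958336799507552365495688197578475743044286804893276)*A+(-48139406279141781619663187131691441326965497903209908600576969295448687970640625)*B)
  have h9 := hq (0) (0) (0) (0) (0)
    (0*c) (0*c)
    (0*c^2+(0)*A+(1)*B)
  simp only [QF] at h0 h1 h2 h3 h4 h5 h6 h7 h8 h9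
  simp only [TT0, TT1, TT2, TT3]
  linear_combination (1/134217728000000000000000000)*h0
    + (1/270702613657301948641772044288000000000000000000)*h1
    + (1/2675605974800431851053498088453709122578324929413867844403200000000000)*h2
    + (1/341948072797704473699250509250847317483802819353188330209674520346158385279795200000000000)*h3
    + (1/944854597214806641355223771717341359196169920680133587519770918846080017115974003287005906914508800)*h4
    + (1/1249658801399631577308627498110862528327912642083511161423142471645780256272313528435707066142062424066421760000000000)*h5
    + (1/15687152571272758344014404440322769231278852805601800689975220350604869852070315569316601395518353103689933903312955661352960000)*h6
    + (1/121104189849291494454443166873866938419954888421146105590819395544668340492415167666180617176869712542604943018796617915587459540892016640000000000)*h7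
    + (1/265719866328695777731335258171513639440952792858702654505666552382109340234846972584894677489209765829690351978102055822443561537679924585190912063632962355200000000)*h8
    + (29500789574174485022715457601089067878218002332576298627742964360691585486705340474863/19257150221977396510892286354650999648394021561460100337373202389036920304036388588748800)*h9

lemma cert1 (hq : ∀ a0 a1 a2 a3 a4 a5 a6 a7, 0 ≤ QF X1 X2 X3 X4 X5 X6 X7 Y1 Y2 Y3 Y4 A B c a0 a1 a2 a3 a4 a5 a6 a7) :
    0 ≤ TT0 X1 X2 X3 X4 X5 X6 X7 Y1 Y2 Y3 Y4 A B c + 242/375 * TT1 X1 X2 X3 X4 X5 X6 X7 Y1 Y2 Y3 Y4 A B c + 19241/46875 * TT2 X1 X2 X3 X4 X5 X6 X7 Y1 Y2 Y3 Y4 A B c + 20164/78125 * TT3 X1 X2 X3 X4 X5 X6 X7 Y1 Y2 Y3 Y4 A B c := by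
  have h0 := hq (3932160000000) (8357452407664) (6917904738084) (6360738419298) (477921302223)
    (724875519720*c) (1394606080000*c)
    (669731407926*c^2+(166904974098)*A+(-2491718544375)*B)
  have h1 := hq (0) (129442699471208197128944) (-1271098380644944642236) (203673047844814021206258) (27523278778904653410183)
    (38478396892801323054120*c) (36374836285071687680000*c)
    (-2104541378709327046554*c^2+(-2511808001651728542942)*A+(129948302344242573380625)*B)
  have h2 := hq (0) (0) (685723187032615884387843110230700) (-451646321843287615227448972153770) (-87058390280440094018318551358895)
    (17829231945559349271554957819264*c) (-13944887855505838931287721700000*c)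
    (-32673610135932350568344037816654*c^2+(13962795485225144029376282622798)*A+(-743177253996592948486855310990625)*B)
  have h3 := hq (0) (0) (0) (160460164957305142574551183871966481374380) (17314041039999516517230591114277402640505)
    (-142959901955235193161140777162243493453136*c) (-118701901773462781286993411034405241450000*c)
    (24254857931198722237182806201916371531556*c^2+(8712769728725744643741472493639495286403)*A+(72555690699187159333634329962380984290625)*B)
  have h4 := hq (0) (0) (0) (0) (1663660408085778268299874968630889650288593655)
    (124383910690601735154118423967155928951528244*c) (-8386567353795523659292044744264862378020200*c)
    (-132295502945941216583690674437477958857863240*c^2+(-11550318095464683430756270731661020829602295)*A+(210968410698847496029258505743425342271886875)*B)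
  have h5 := hq (0) (0) (0) (0) (0)
    (27461206523768903779880719134309740965998877558577835074*c) (29223233022228273270032914283235382628136913584258750000*c)
    (3087286838550477228049705774344583517513506579676179542*c^2+(-1598371610949955140371451110325466886264107009769546049)*A+(3977755820859133210061248904311267103944737550666875000)*B)
  have h6 := hq (0) (0) (0) (0) (0)
    (0*c) (47942632389500060799807858860339884580355078111468596030242860*c)
    (45777005017320944792527266932770005655207323424056969581028082*c^2+(413547907382173114559707497732616051203785520594164761298561)*A+(-806723227307738957328328865765679398588088266044784688525410)*B)
  have h7 := hq (0) (0) (0) (0) (0)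
    (0*c) (0*c)
    (64071927256580062340653776490062765080862275336935781788497992995174372*c^2+(-2337305269836116636983576561687797885724541615369293038058235308286269)*A+(-41217743998102479755364967053356483157078326589956127915735368631640625)*B)
  have h8 := hq (0) (0) (0) (0) (0)
    (0*c) (0*c)
    (0*c^2+(57173008636616200322742622725177425592327784878250988772864024839890463579933342)*A+(5722737225057796966319681538329664843166737733776732556844577340303466812765625)*B)
  have h9 := hq (0) (0) (0) (0) (0)
    (0*c) (0*c)
    (0*c^2+(0)*A+(1)*B)
  simp only [QF] at h0 h1 h2 h3 h4 h5 h6 h7 h8 h9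
  simp only [TT0, TT1, TT2, TT3]
  linear_combination (1/1932735283200000000000000)*h0
    + (1/15636154526291129070260688047308800000000000000)*h1
    + (1/43628229633393617041778430778493801568577016489650117410816000000000)*h2
    + (1/1802752093492061003559933080818405901946132197482319359560569336215461330944000000000)*h3
    + (1/1119674584591264681431037258971736318972602155659572317075322806328274876374488963073284505600)*h4
    + (1/14970428473953881588099719243267294504050286842489317993259235931711208181311045402663661773125338880409600000000)*h5
    + (1/20707738061497068435899131802364804875096711363826976041553883640123093935654262559825090646805634643335011933818532239769600)*h6
    + (1/34314539994193998970885473086026112490388320903913123464954556291369095372436045771765504384630467538199639780307678685992973494278553600000000)*h7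
    + (1/1320387652958816343723229032989761820851746342800580937441284207994130956653123108403723170654088351693879706357996757263737035080916314711041431759207268352000000)*h8
    + (4070300058580978108497597319228984220948497583898799538916826932571422700345842483587/479601957633187750956961346933405153743205594851975270427957341684103861910337472167936)*h9

lemma cert2 (hq : ∀ a0 a1 a2 a3 a4 a5 a6 a7, 0 ≤ QF X1 X2 X3 X4 X5 X6 X7 Y1 Y2 Y3 Y4 A B c a0 a1 a2 a3 a4 a5 a6 a7) :
    0 ≤ TT0 X1 X2 X3 X4 X5 X6 X7 Y1 Y2 Y3 Y4 A B c + 271/375 * TT1 X1 X2 X3 X4 X5 X6 X7 Y1 Y2 Y3 Y4 A B c + 968/1875 * TT2 X1 X2 X3 X4 X5 X6 X7 Y1 Y2 Y3 Y4 A B c + 1136/3125 * TT3 X1 X2 X3 X4 X5 X6 X7 Y1 Y2 Y3 Y4 A B c := by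
  have h0 := hq (2457600000) (5707673924) (4582732719) (4619629728) (364051083)
    (443251465*c) (681574400*c)
    (238344246*c^2+(91229208)*A+(-1328380800)*B)
  have h1 := hq (0) (201491840274610556) (7445669775520161) (338884965739796832) (44329101639235077)
    (50811811376375335*c) (96239932463513600*c)
    (45430510542589674*c^2+(3628157097806952)*A+(186764073325564800)*B)
  have h2 := hq (0) (0) (1400605736459575747661975) (-2598901803115470296928390) (-410593031668705106313915)
    (-89209378215714239916664*c) (-436044954589558993515750*c)
    (-323363738084089269237666*c^2+(-49394310529413712578898)*A+(-2457196925737990202289750)*B)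
  have h3 := hq (0) (0) (0) (1458927705197552563063016354470) (155664497561798021812305164670)
    (-3141472274107258782755005250343*c) (-4465520361974861612145056312750*c)
    (-1288882758772747457903056672872*c^2+(238440688452127155888303808834)*A+(387223390858447439773163639250)*B)
  have h4 := hq (0) (0) (0) (0) (5617488007742451899444987853320)
    (-475397383018829236040304211394*c) (-625564697314551520570519187680*c)
    (-173522391019851086365518839229*c^2+(43457210496089957777127132658)*A+(580765385797256202520482169200)*B)
  have h5 := hq (0) (0) (0) (0) (0)
    (2037091006631659623993679955109109269346*c) (2847693762962684331005859581886119787500*c)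
    (1012013532010779243543979995872356935543*c^2+(-114697974762273142119935896786136280686)*A+(528811412704260015101257205810794912500)*B)
  have h6 := hq (0) (0) (0) (0) (0)
    (0*c) (93755506719208950505609861977579181666135520*c)
    (77734993059323552884060999627504569835927947*c^2+(-22506990840572767321469231979977348197834)*A+(425370851094518012233971483756339086428920)*B)
  have h7 := hq (0) (0) (0) (0) (0)
    (0*c) (0*c)
    (2901879782332424963821250189299019010906649768228413*c^2+(-119754017039441847289822234018940842035402391846)*A+(-192598146774477633614386109597246898174781689375000)*B)
  have h8 := hq (0) (0) (0) (0) (0)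
    (0*c) (0*c)
    (0*c^2+(101463827769495111885133343097626697863243015682322170911)*A+(-3269058842229978074262243230055525809473318512037404375)*B)
  have h9 := hq (0) (0) (0) (0) (0)
    (0*c) (0*c)
    (0*c^2+(0)*A+(1)*B)
  simp only [QF] at h0 h1 h2 h3 h4 h5 h6 h7 h8 h9
  simp only [TT0, TT1, TT2, TT3]
  linear_combination (1/754974720000000000)*h0
    + (1/38030311423402206906286080000000000)*h1
    + (1/86695104718361432998422714892360905157048320000000)*h2
    + (1/83696947731640194002472841417608865670447402612337797120000000)*h3
    + (1/4630179918027651275181625617874645874413756817119674077800038400)*h4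
    + (1/50973188307850303066167019650668951019628623891826044511907345877432250368000000)*h5
    + (1/93874667303679437356041566267966645126466591121352518528970047332165670747480606271078400)*h6
    + (1/55719364491428715609056041053106084589741868516306433709102407243848361037691211015468313094094848000000)*h7
    + (1/1507511451864868509710009997152611333297875790755227218575178523173829372500813235511770639404855053682146524160000)*h8
    + (24568103838982940693697940055482754853972523740856696931767/1662383354175407913126024693311515817791373568939166448205824)*h9

lemma cert3 (hq : ∀ a0 a1 a2 a3 a4 a5 a6 a7, 0 ≤ QF X1 X2 X3 X4 X5 X6 X7 Y1 Y2 Y3 Y4 A B c a0 a1 a2 a3 a4 a5 a6 a7) :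
    0 ≤ TT0 X1 X2 X3 X4 X5 X6 X7 Y1 Y2 Y3 Y4 A B c + 4/5 * TT1 X1 X2 X3 X4 X5 X6 X7 Y1 Y2 Y3 Y4 A B c + 16/25 * TT2 X1 X2 X3 X4 X5 X6 X7 Y1 Y2 Y3 Y4 A B c + 64/125 * TT3 X1 X2 X3 X4 X5 X6 X7 Y1 Y2 Y3 Y4 A B c := by
  have h0 := hq (32768000) (81879192) (64727002) (69985204) (5806759)
    (5658180*c) (6553600*c)
    (894733*c^2+(1135634)*A+(-15574450)*B)
  have h1 := hq (0) (16983610078392) (1114535957202) (32383577565604) (4091224117659)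
    (4974553000180*c) (15954581913600*c)
    (10984578113033*c^2+(1287492709034)*A+(15187882730550)*B)
  have h2 := hq (0) (0) (46903438870582000) (-44998977805804300) (-7423189078430800)
    (-4776655304025053*c) (-32082871997328500*c)
    (-27286850073662322*c^2+(-3139188891283196)*A+(-48897935107252375)*B)
  have h3 := hq (0) (0) (0) (19089875006067857950100) (2335916418079679835600)
    (-16387091849550374880649*c) (-15073664205294949840500*c)
    (1293613836185595420934*c^2+(2141121843105881782612)*A+(5510219665583574049125)*B)
  have h4 := hq (0) (0) (0) (0) (9449763406791556912647300)
    (-820943932076513603440671*c) (-592829415635807398156100*c)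
    (223443109138241659297540*c^2+(119610507088355353433820)*A+(628183810774474776349475)*B)
  have h5 := hq (0) (0) (0) (0) (0)
    (25055050461505947631707511927083*c) (24710679417402522164200748987500*c)
    (409438673550028827258583389724*c^2+(-889033018395757623068859926868)*A+(2849636828043078683705213107625)*B)
  have h6 := hq (0) (0) (0) (0) (0)
    (0*c) (85968451886839345011354047429355563800*c)
    (84146498205671892176335241500609220281*c^2+(-288262108289113272413163693000032292)*A+(1328427428855964714404744538745327850)*B)
  have h7 := hq (0) (0) (0) (0) (0)
    (0*c) (0*c)
    (634470581624584511932128933810968287456003599*c^2+(-15646045470087840476124360716749446045847468)*A+(-206594674163530494284018595949100891382983250)*B)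
  have h8 := hq (0) (0) (0) (0) (0)
    (0*c) (0*c)
    (0*c^2+(212326517016521618288262168219525384367089467752)*A+(110911268091439816108427524345768615136282103195)*B)
  have h9 := hq (0) (0) (0) (0) (0)
    (0*c) (0*c)
    (0*c^2+(0)*A+(1)*B)
  simp only [QF] at h0 h1 h2 h3 h4 h5 h6 h7 h8 h9
  simp only [TT0, TT1, TT2, TT3]
  linear_combination (1/134217728000000)*h0
    + (1/284937694744959516672000000)*h1
    + (1/30211402604606939627621040128000000)*h2
    + (1/1980439036366207710459743399958681305088000000)*h3
    + (1/5911176880867403187233983202376532968810077552640000)*h4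
    + (1/1293048758307251890700255059665324086913200188719632798515200000)*h5
    + (1/5293532528940579190440030604561556532152543487033051943032289577522135040000)*h6
    + (1/223414082232353050813708349879667596456221432650243136785566932909293756184469979955200000)*h7
    + (1/2758961740713875696751143877764538385483473293756394968807204541236260675539605816809603879895040)*h8
    + (134090722853312343987473874086839203659598891748109/869689413699672548508721841027175974367598459912192)*h9

lemma cert4 (hq : ∀ a0 a1 a2 a3 a4 a5 a6 a7, 0 ≤ QF X1 X2 X3 X4 X5 X6 X7 Y1 Y2 Y3 Y4 A B c a0 a1 a2 a3 a4 a5 a6 a7) :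
    0 ≤ TT0 X1 X2 X3 X4 X5 X6 X7 Y1 Y2 Y3 Y4 A B c + 4459/5000 * TT1 X1 X2 X3 X4 X5 X6 X7 Y1 Y2 Y3 Y4 A B c + 2459/3125 * TT2 X1 X2 X3 X4 X5 X6 X7 Y1 Y2 Y3 Y4 A B c + 10754/15625 * TT3 X1 X2 X3 X4 X5 X6 X7 Y1 Y2 Y3 Y4 A B c := by
  have h0 := hq (4096000000) (10651206612) (8738823947) (9291899164) (737134154)
    (391767795*c) (443187200*c)
    (51437973*c^2+(171321654)*A+(-2170624775)*B)
  have h1 := hq (0) (666947100081870364) (25477148652415609) (1457483546591481908) (239749956246043438)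
    (123340795177834865*c) (214408391251558400*c)
    (90934880468630631*c^2+(35772416534105938)*A+(600935238912753075)*B)
  have h2 := hq (0) (0) (18667753069484332703515325) (-45872868705067793664507830) (-9230290417158762074416880)
    (-4809053354282387280791508*c) (-8696401078976214148677750*c)
    (-4053160774417087909480877*c^2+(-1312990042301715856383806)*A+(-31478455540185386999452625)*B)
  have h3 := hq (0) (0) (0) (74964433504694825040997267854510) (12893697411846926701578920638610)
    (4754024055685472556259888683281*c) (13365769951887037990654741804250*c)
    (5850225958247888942662839473124*c^2+(355053688498508152512519795472)*A+(71950540282426502273013071389000)*B)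
  have h4 := hq (0) (0) (0) (0) (7767175857500874148417999670284495)
    (139279667350919317159999838772712*c) (262981749703171626767400858348835*c)
    (104426102380202963082031438231326*c^2+(41997459778695566620826685558368)*A+(932129518588028874650199866956520)*B)
  have h5 := hq (0) (0) (0) (0) (0)
    (2979835741610855071275831162485139295872193*c) (6506074487882808083952512795215682520625000*c)
    (3622679315413204075836214395372919133441744*c^2+(270864872490324340018467807263079907962)*A+(6608820917708546169858914288614843875000)*B)
  have h6 := hq (0) (0) (0) (0) (0)
    (0*c) (712490565038476328850582585346496533397421740350*c)
    (703043538579240243670883137565628302042440165426*c^2+(-6473886431598508903084342152070759202055427)*A+(-143870750902969372605848988291911377156938665)*B)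
  have h7 := hq (0) (0) (0) (0) (0)
    (0*c) (0*c)
    (127246672207763316983987622855607496386537923796541693928*c^2+(3670824973821579783307883738388559260471122470456934149)*A+(-84144048773405990415142482769596847509986574908510590625)*B)
  have h8 := hq (0) (0) (0) (0) (0)
    (0*c) (0*c)
    (0*c^2+(18995185571935498004608253287235367957658764451465039794477011)*A+(-42047903340664122627320766247679503900394027518664937698689375)*B)
  have h9 := hq (0) (0) (0) (0) (0)
    (0*c) (0*c)
    (0*c^2+(0)*A+(1)*B)
  simp only [QF] at h0 h1 h2 h3 h4 h5 h6 h7 h8 h9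
  simp only [TT0, TT1, TT2, TT3]
  linear_combination (1/2097152000000000000)*h0
    + (1/349672361207723649400832000000000000)*h1
    + (1/6374606732665349084623618777621198713512089600000000)*h2
    + (1/286600710893449415232372419033020262658259303648799818905600000000)*h3
    + (1/4769889796824230199333476737539745538046265203848030664539904593510400)*h4
    + (1/23700386029115439603962373664496507211983641654397775644586375925919200816675840000000)*h5
    + (1/173924749415396579719689921568257792773991040204270769740830990097472616495887934523890692096000)*h6
    + (1/4641897133085443476951225667341316458412807638454624899386201625063688750311484221567817263933582724853760000000)*h7
    + (1/22500763014960514149476016823505439900142073627614606845105369361938304049906037336362717721222602401538795713575928627200000)*h8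
    + (1185456879579180101664374197867632043830279461736888764332962665361/2139617702822814495239073650274191846750683227813022082449890519040)*h9

lemma cert5 (hq : ∀ a0 a1 a2 a3 a4 a5 a6 a7, 0 ≤ QF X1 X2 X3 X4 X5 X6 X7 Y1 Y2 Y3 Y4 A B c a0 a1 a2 a3 a4 a5 a6 a7) :
    0 ≤ TT0 X1 X2 X3 X4 X5 X6 X7 Y1 Y2 Y3 Y4 A B c + 2459/2500 * TT1 X1 X2 X3 X4 X5 X6 X7 Y1 Y2 Y3 Y4 A B c + 23976043/25000000 * TT2 X1 X2 X3 X4 X5 X6 X7 Y1 Y2 Y3 Y4 A B c + 28912129/31250000 * TT3 X1 X2 X3 X4 X5 X6 X7 Y1 Y2 Y3 Y4 A B c := by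
  have h0 := hq (2048000000000) (5560088525028) (4686803468743) (4995408014996) (385178743221)
    (71182707440*c) (33587200000*c)
    (-37610940723*c^2+(108522493221)*A+(-1172266571875)*B)
  have h1 := hq (0) (199023737833229854399804) (685453595154757200049) (481610304496960263670028) (87977022433052839041203)
    (13591941388279689547920*c) (34505048673044889600000*c)
    (20924039982365152478811*c^2+(7501332683622245291203)*A+(194172478639024674596875)*B)
  have h2 := hq (0) (0) (1828714662824765556402278092098025) (-3707830638440385199140426915091390) (-862669682839892729948985099978515)
    (-130447791092471053600799807187702*c) (-378218764196326214259555057375000*c)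
    (-243864509823183586160124608870903*c^2+(-51332919467155033777893538473889)*A+(-2602463407322177108570761740171875)*B)
  have h3 := hq (0) (0) (0) (4031260680866346435653044704906144598528545) (753386115790016364434936314300207931205545)
    (110201939467499907367908830336634240526601*c) (331633157777004180428190794764348508062500*c)
    (223713132193535616774566274744115617265929*c^2+(42511445479099907980923449412012147149402)*A+(2128769741260575989941651780232299056453125)*B)
  have h4 := hq (0) (0) (0) (0) (1696578688369745623095256267545024988185370750)
    (12345284992845539493570464324843482213947259*c) (30768910606447418282655996829329751922784030*c)
    (15999189445902160692676505627855203212170685*c^2+(5104159420695693710879648992069879752441910)*A+(224322948959954435449135592652053220496885480)*B)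
  have h5 := hq (0) (0) (0) (0) (0)
    (5664373899511660583733673419065322861228154731464604321*c) (13069595843680094486379265556964794875247748413761250000*c)
    (7458575840670544754248771809349943071493108271313016993*c^2+(-38804824388866052196995187041504925045748323867846)*A+(980467365475161066947781339747092231914339625312500)*B)
  have h6 := hq (0) (0) (0) (0) (0)
    (0*c) (236485424949662906752584900941958691658178616597306752335302505*c)
    (235541780559304750202973208284035688945854167819615122478089473*c^2+(1889751758370579766029577307272418238310863871787607812424)*A+(3302736506157943934507414202937315398710845062615450449830)*B)
  have h7 := hq (0) (0) (0) (0) (0)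
    (0*c) (0*c)
    (188406727190147885530084613587542114342714649468417668456052616777014043219*c^2+(5172260833415910026809369193061748303984804624358288607109634284941476762)*A+(-125880572185540882185252438038940878154802284267667919769129816916197265625)*B)
  have h8 := hq (0) (0) (0) (0) (0)
    (0*c) (0*c)
    (0*c^2+(47245340166529016161884452247376741656374710264842338924142052294957405279265652391)*A+(-210378539894002530759325034863437284627472076418784822243651479574212487055303515625)*B)
  have h9 := hq (0) (0) (0) (0) (0)
    (0*c) (0*c)
    (0*c^2+(0)*A+(1)*B)
  simp only [QF] at h0 h1 h2 h3 h4 h5 h6 h7 h8 h9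
  simp only [TT0, TT1, TT2, TT3]
  linear_combination (1/524288000000000000000000)*h0
    + (1/26086439365277103475891109888000000000000000000)*h1
    + (1/93173152672209784173652922983390877255044432581506249497600000000000)*h2
    + (1/377447706458584860042625076835431970802865016416451522261330632417633311929600000000000)*h3
    + (1/448223704411062516544966052885281025865981234714168945876555826941970399895233841270538240000)*h4
    + (1/49203486929250889783150772452773937246443994151064914560878526134981358227492750659406927101117495040000000000)*h5
    + (1/10973526988388714319315460935529009532345147401098484673473396424338186186406468524174394028781751532989313348936696668160000)*h6
    + (1/5703096952695978435510097697481938464528249627255024953474617043224988339280801971626953082653041006657939941785407505237292774337147340160000000000)*h7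
    + (1/113937150921740395768394494725321069828490338345892854320642388872266504160937991536925609895014957092014340811110171250311273921043801104507203168290619988851200000000)*h8
    + (2455307305664739707520581539287681961596569394434027726874659744584246050473059867154783/3096270613153645603185259462484082141192173011916707523732573539202328512381953795096576)*h9

lemma cert6 (hq : ∀ a0 a1 a2 a3 a4 a5 a6 a7, 0 ≤ QF X1 X2 X3 X4 X5 X6 X7 Y1 Y2 Y3 Y4 A B c a0 a1 a2 a3 a4 a5 a6 a7) :
    0 ≤ TT0 X1 X2 X3 X4 X5 X6 X7 Y1 Y2 Y3 Y4 A B c + 5377/5000 * TT1 X1 X2 X3 X4 X5 X6 X7 Y1 Y2 Y3 Y4 A B c + 28912129/25000000 * TT2 X1 X2 X3 X4 X5 X6 X7 Y1 Y2 Y3 Y4 A B c + 155460517633/125000000000 * TT3 X1 X2 X3 X4 X5 X6 X7 Y1 Y2 Y3 Y4 A B c := by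
  have h0 := hq (256000000000000) (732294495638508) (623531176090373) (688429023862086) (53625465641726)
    (-25313786116250*c) (-19302400000000*c)
    (6009493950712*c^2+(17046119938601)*A+(-147118170703125)*B)
  have h1 := hq (0) (3392662889597316941346883484) (-23080777496353644936720871) (8815303797000835953824298078) (1722185421128029771415703798)
    (-852164956546766002683861250*c) (-1751614681846815795200000000*c)
    (-899367335419827223480304424*c^2+(95367549242166437187188173)*A+(3386144153576211434046484375)*B)
  have h2 := hq (0) (0) (1543434441255330078428985520233249887275) (-2492790496462785443668273048349276522380) (-656232124934693275923627167356124447955)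
    (328665439372043264491444606932017851129*c) (747825191948792581740437441052156250000*c)
    (421515708599532299950991402284851965486*c^2+(-7865139348865829060122911097794116522)*A+(-1821159432254766551008262678586480468750)*B)
  have h3 := hq (0) (0) (0) (433801080250787189211035706385991874158903967736960) (85196803691253657680754866175643987621538470594235)
    (-41783276065266715581961617696354220968074595165423*c) (-84805348142827533054804423335958120304618003906250*c)
    (-42846562376815912638071001406686338724307884103592*c^2+(3133422945118020858654648623378490841239476074909)*A+(192104152432090941639293729838696743558488771484375)*B)
  have h4 := hq (0) (0) (0) (0) (235702896919896987304215692737192542671749190725122425)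
    (-4937355899316157315370367055328078499077576643493237*c) (-17216178556046557498499630160251223626730163502097230*c)
    (-11884855148798770337228756673273900500433284987194936*c^2+(-92006150603635018440457827999658223632770974031793)*A+(33011537088692676972668736988887813523000830867157485)*B)
  have h5 := hq (0) (0) (0) (0) (0)
    (877738178953714439308288842992056273823566115193765497126192954946*c) (2004423129604253429353220894540352235947704159448069708020214843750*c)
    (1132636752962499922170024624723011672837392751446887294000149978293*c^2+(-32808731188743539157847952801512099805979518438855498115077556)*A+(-444259264760688830173843972651215451043227743696601743554687500)*B)
  have h6 := hq (0) (0) (0) (0) (0)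
    (0*c) (53027966633943354606830416057752274235381933359348961022309766552668636*c)
    (52914986823738567234476006377907941313179339153394199928611138476947321*c^2+(1565224797959354815410651517588067565399347827784833913777167708104)*A+(-1405114468222058224886692898247950807621205572706402101746349877952)*B)
  have h7 := hq (0) (0) (0) (0) (0)
    (0*c) (0*c)
    (669062096794104880980403773183486323095405564352931860600801373825059159282227055157387*c^2+(14335219318575176335796791681798302966229962283903010980262759536190539048997800817456)*A+(-494338939709182284309498630867854693919103347537508957802629720118502065792996093750000)*B)
  have h8 := hq (0) (0) (0) (0) (0)
    (0*c) (0*c)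
    (0*c^2+(216083912653571677630112824374108989515486809031906130475642009417204107501161193055878585107180877)*A+(-863979564460295149612742317153928284771943358663082415444570160284199221434079138970404400195312500)*B)
  have h9 := hq (0) (0) (0) (0) (0)
    (0*c) (0*c)
    (0*c^2+(0)*A+(1)*B)
  simp only [QF] at h0 h1 h2 h3 h4 h5 h6 h7 h8 h9
  simp only [TT0, TT1, TT2, TT3]
  linear_combination (1/8192000000000000000000000000)*h0
    + (1/6948173597895305095878417375232000000000000000000000000)*h1
    + (1/83781644021973255522424775601831031428412544167596160629048948257600000000000000)*h2
    + (1/4285078578642126905810612871607601470314333291578791978678477208314965406280935403847577600000000000000)*h3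
    + (1/13401872308907704790385230744997109655143881767825291846717010552320085888236206841896408644314227976175616000)*h4
    + (1/1324066761706146878485698370739791063019614774826085442521230261949890158185091839993862663761492737012208385589499289920000000000000)*h5
    + (1/462174477262557759860434842438508508789509359979500125539526468890183300275248416856354566736205339380464743547686305318242072328405723381760)*h6
    + (1/62443044478907791971355818579983405900660656956493310331458362651680745346302149172307934225251151162053071026651713142567007796777150128908510453326435960872320000000000000)*h7
    + (1/1387906134561339631305447368811775053418670228630524512675371470839597197961784852732534882453055087264265806597612364357606408055725356678961503289161318009443396246603431765994672208630400000000000)*h8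
    + (11295958753868390845518553640631478527565280440282856857533552535281081701706395497060610177861234931325/14161275299664473465167074058181606736886943516715000166851674729165888389196099948110058953584205955072)*h9

lemma cert_all (hq : ∀ a0 a1 a2 a3 a4 a5 a6 a7, 0 ≤ QF X1 X2 X3 X4 X5 X6 X7 Y1 Y2 Y3 Y4 A B c a0 a1 a2 a3 a4 a5 a6 a7) (s : ℝ)
    (h1 : 71/125 ≤ s) (h2 : s ≤ 5377/5000) :
    0 ≤ TT0 X1 X2 X3 X4 X5 X6 X7 Y1 Y2 Y3 Y4 A B c + s * TT1 X1 X2 X3 X4 X5 X6 X7 Y1 Y2 Y3 Y4 A B c + s ^ 2 * TT2 X1 X2 X3 X4 X5 X6 X7 Y1 Y2 Y3 Y4 A B c + s ^ 3 * TT3 X1 X2 X3 X4 X5 X6 X7 Y1 Y2 Y3 Y4 A B c := by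
  have c0 := cert0 hq
  have c1 := cert1 hq
  have c2 := cert2 hq
  have c3 := cert3 hq
  have c4 := cert4 hq
  have c5 := cert5 hq
  have c6 := cert6 hq
  generalize TT0 X1 X2 X3 X4 X5 X6 X7 Y1 Y2 Y3 Y4 A B c = t0 at *
  generalize TT1 X1 X2 X3 X4 X5 X6 X7 Y1 Y2 Y3 Y4 A B c = t1 at *
  generalize TT2 X1 X2 X3 X4 X5 X6 X7 Y1 Y2 Y3 Y4 A B c = t2 at *
  generalize TT3 X1 X2 X3 X4 X5 X6 X7 Y1 Y2 Y3 Y4 A B c = t3 at *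
  clear hq
  rcases le_total s (4/5) with h3 | h3
  · have u : 0 ≤ s - 71/125 := by linarith
    have v : 0 ≤ 4/5 - s := by linarith
    have e0 := mul_nonneg (pow_nonneg v 3) c0
    have e1 := mul_nonneg (mul_nonneg (pow_nonneg v 2) u) c1
    have e2 := mul_nonneg (mul_nonneg v (pow_nonneg u 2)) c2
    have e3 := mul_nonneg (pow_nonneg u 3) c3
    linear_combination (e0 + 3 * e1 + 3 * e2 + e3) * (1953125/24389)
  · have u : 0 ≤ s - 4/5 := by linarith
    have v : 0 ≤ 5377/5000 - s := by linarith
    have e0 := mul_nonneg (pow_nonneg v 3) c3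
    have e1 := mul_nonneg (mul_nonneg (pow_nonneg v 2) u) c4
    have e2 := mul_nonneg (mul_nonneg v (pow_nonneg u 2)) c5
    have e3 := mul_nonneg (pow_nonneg u 3) c6
    linear_combination (e0 + 3 * e1 + 3 * e2 + e3) * (125000000000/2610969633)

end cert

/-! ### Assembling -/

section A
variable {f : ℝ → ℝ} {α a b s : ℝ}

/-- canonical form of the derivative number 1 -/
noncomputable def J1 (f : ℝ → ℝ) (α t : ℝ) : ℝ :=
  ((-2))*mom f α 0 2 0 0 0 t
  + ((1/3) + (-1/3)*α⁻¹^1)*mom f α 4 0 0 0 0 t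

/-- canonical form of the derivative number 2 -/
noncomputable def J2 (f : ℝ → ℝ) (α t : ℝ) : ℝ :=
  ((-4) + (-4)*α⁻¹^1)*mom f α 0 3 0 0 0 t
  + ((4))*mom f α 0 0 2 0 0 t
  + ((-6) + (6)*α⁻¹^1)*mom f α 2 2 0 0 0 t
  + ((1/5) + (-2/5)*α⁻¹^1 + (1/5)*α⁻¹^2)*mom f α 6 0 0 0 0 t

/-- canonical form of the derivative number 3 -/
noncomputable def J3 (f : ℝ → ℝ) (α t : ℝ) : ℝ :=
  ((-12) + (-20)*α⁻¹^1 + (-16)*α⁻¹^2)*mom f α 0 4 0 0 0 t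
  + ((32) + (64)*α⁻¹^1)*mom f α 0 1 2 0 0 t
  + ((-32) + (16)*α⁻¹^1 + (16)*α⁻¹^2)*mom f α 2 3 0 0 0 t
  + ((-8))*mom f α 0 0 0 2 0 t
  + ((16) + (-16)*α⁻¹^1)*mom f α 2 0 2 0 0 t
  + ((-12) + (24)*α⁻¹^1 + (-12)*α⁻¹^2)*mom f α 4 2 0 0 0 t
  + ((1/7) + (-3/7)*α⁻¹^1 + (3/7)*α⁻¹^2 + (-1/7)*α⁻¹^3)*mom f α 8 0 0 0 0 t

lemma M_dt (h : Ctx f α a b s) {t : ℝ} (ht : t ∈ Set.Ioo a b) :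
    HasDerivAt (fun t => mom f α 0 0 0 0 0 t) (1 / 2 * ((α⁻¹ - 1) * mom f α 2 0 0 0 0 t)) t := by
  refine (mom_dt h ht 0 0 0).congr_deriv ?_
  have r_1_0_0_0 : (1)*mom f α 0 1 0 0 0 t + (1)*mom f α 2 0 0 0 0 t = 0 := by
    have := mom_ibp h ht 1 0 0 0
    norm_num at this ⊢
    linarith
  norm_num
  linear_combination r_1_0_0_0

lemma J0_dt (h : Ctx f α a b s) {t : ℝ} (ht : t ∈ Set.Ioo a b) :
    HasDerivAt (fun t => mom f α 2 0 0 0 0 t) (1 / 2 * J1 f α t) t := by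
  have r_1_1_0_0 : (1)*mom f α 0 2 0 0 0 t + (1)*mom f α 1 0 1 0 0 t + (1)*mom f α 2 1 0 0 0 t = 0 := by
    have := mom_ibp h ht 1 1 0 0
    norm_num at this ⊢
    linarith
  have r_3_0_0_0 : (3)*mom f α 2 1 0 0 0 t + (1)*mom f α 4 0 0 0 0 t = 0 := by
    have := mom_ibp h ht 3 0 0 0
    norm_num at this ⊢
    linarith
  refine (mom_dt h ht 2 0 0).congr_deriv ?_
  simp only [J1]
  norm_num
  linear_combination (((2))*r_1_1_0_0
    + ((-1/3) + (4/3)*α⁻¹^1)*r_3_0_0_0)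

lemma J1_dt (h : Ctx f α a b s) {t : ℝ} (ht : t ∈ Set.Ioo a b) :
    HasDerivAt (fun t => J1 f α t) (1 / 2 * J2 f α t) t := by
  have r_0_1_1_0 : (1)*mom f α 0 0 2 0 0 t + (1)*mom f α 0 1 0 1 0 t + (1)*mom f α 1 1 1 0 0 t = 0 := by
    have := mom_ibp h ht 0 1 1 0
    norm_num at this ⊢
    linarith
  have r_3_1_0_0 : (3)*mom f α 2 2 0 0 0 t + (1)*mom f α 3 0 1 0 0 t + (1)*mom f α 4 1 0 0 0 t = 0 := by
    have := mom_ibp h ht 3 1 0 0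
    norm_num at this ⊢
    linarith
  have r_1_2_0_0 : (1)*mom f α 0 3 0 0 0 t + (2)*mom f α 1 1 1 0 0 t + (1)*mom f α 2 2 0 0 0 t = 0 := by
    have := mom_ibp h ht 1 2 0 0
    norm_num at this ⊢
    linarith
  have r_5_0_0_0 : (5)*mom f α 4 1 0 0 0 t + (1)*mom f α 6 0 0 0 0 t = 0 := by
    have := mom_ibp h ht 5 0 0 0
    norm_num at this ⊢
    linarith
  refine ((((mom_dt h ht 0 2 0).const_mul ((-2))).fun_add
    ((mom_dt h ht 4 0 0).const_mul ((1/3) + (-1/3)*α⁻¹^1)))).congr_deriv ?_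
  simp only [J2]
  norm_num
  linear_combination (1 / 2) * (((-4))*r_0_1_1_0
    + ((4/3) + (-4/3)*α⁻¹^1)*r_3_1_0_0
    + ((2) + (-4)*α⁻¹^1)*r_1_2_0_0
    + ((-1/5) + (11/15)*α⁻¹^1 + (-8/15)*α⁻¹^2)*r_5_0_0_0)

lemma J2_dt (h : Ctx f α a b s) {t : ℝ} (ht : t ∈ Set.Ioo a b) :
    HasDerivAt (fun t => J2 f α t) (1 / 2 * J3 f α t) t := by
  have r_0_0_1_1 : (1)*mom f α 0 0 0 2 0 t + (1)*mom f α 0 0 1 0 1 t + (1)*mom f α 1 0 1 1 0 t = 0 := by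
    have := mom_ibp h ht 0 0 1 1
    norm_num at this ⊢
    linarith
  have r_2_1_1_0 : (2)*mom f α 1 2 1 0 0 t + (1)*mom f α 2 0 2 0 0 t + (1)*mom f α 2 1 0 1 0 t + (1)*mom f α 3 1 1 0 0 t = 0 := by
    have := mom_ibp h ht 2 1 1 0
    norm_num at this ⊢
    linarith
  have r_1_0_2_0 : (1)*mom f α 0 1 2 0 0 t + (2)*mom f α 1 0 1 1 0 t + (1)*mom f α 2 0 2 0 0 t = 0 := by
    have := mom_ibp h ht 1 0 2 0
    norm_num at this ⊢
    linarith
  have r_0_2_1_0 : (2)*mom f α 0 1 2 0 0 t + (1)*mom f α 0 2 0 1 0 t + (1)*mom f α 1 2 1 0 0 t = 0 := by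
    have := mom_ibp h ht 0 2 1 0
    norm_num at this ⊢
    linarith
  have r_5_1_0_0 : (5)*mom f α 4 2 0 0 0 t + (1)*mom f α 5 0 1 0 0 t + (1)*mom f α 6 1 0 0 0 t = 0 := by
    have := mom_ibp h ht 5 1 0 0
    norm_num at this ⊢
    linarith
  have r_3_2_0_0 : (3)*mom f α 2 3 0 0 0 t + (2)*mom f α 3 1 1 0 0 t + (1)*mom f α 4 2 0 0 0 t = 0 := by
    have := mom_ibp h ht 3 2 0 0
    norm_num at this ⊢
    linarith
  have r_1_3_0_0 : (1)*mom f α 0 4 0 0 0 t + (3)*mom f α 1 2 1 0 0 t + (1)*mom f α 2 3 0 0 0 t = 0 := by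
    have := mom_ibp h ht 1 3 0 0
    norm_num at this ⊢
    linarith
  have r_7_0_0_0 : (7)*mom f α 6 1 0 0 0 t + (1)*mom f α 8 0 0 0 0 t = 0 := by
    have := mom_ibp h ht 7 0 0 0
    norm_num at this ⊢
    linarith
  refine ((((((mom_dt h ht 0 3 0).const_mul ((-4) + (-4)*α⁻¹^1)).fun_add
    ((mom_dt h ht 0 0 2).const_mul ((4)))).fun_add
    ((mom_dt h ht 2 2 0).const_mul ((-6) + (6)*α⁻¹^1))).fun_add
    ((mom_dt h ht 6 0 0).const_mul ((1/5) + (-2/5)*α⁻¹^1 + (1/5)*α⁻¹^2)))).congr_deriv ?_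
  simp only [J3]
  norm_num
  linear_combination (1 / 2) * (((8))*r_0_0_1_1
    + ((-12) + (12)*α⁻¹^1)*r_2_1_1_0
    + ((-4) + (8)*α⁻¹^1)*r_1_0_2_0
    + ((-12) + (-12)*α⁻¹^1)*r_0_2_1_0
    + ((6/5) + (-12/5)*α⁻¹^1 + (6/5)*α⁻¹^2)*r_5_1_0_0
    + ((6) + (-18)*α⁻¹^1 + (12)*α⁻¹^2)*r_3_2_0_0
    + ((8) + (-8)*α⁻¹^1 + (-8)*α⁻¹^2)*r_1_3_0_0
    + ((-1/7) + (22/35)*α⁻¹^1 + (-29/35)*α⁻¹^2 + (12/35)*α⁻¹^3)*r_7_0_0_0)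

lemma QF_nonneg (h : Ctx f α a b s) {t : ℝ} (ht : t ∈ Set.Ioo a b) (a0 a1 a2 a3 a4 a5 a6 a7 : ℝ) :
    0 ≤ QF (mom f α 0 0 0 2 0 t / mom f α 0 0 0 0 0 t)
      (mom f α 0 1 2 0 0 t / mom f α 0 0 0 0 0 t)
      (mom f α 2 0 2 0 0 t / mom f α 0 0 0 0 0 t)
      (mom f α 0 4 0 0 0 t / mom f α 0 0 0 0 0 t)
      (mom f α 2 3 0 0 0 t / mom f α 0 0 0 0 0 t)
      (mom f α 4 2 0 0 0 t / mom f α 0 0 0 0 0 t)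
      (mom f α 8 0 0 0 0 t / mom f α 0 0 0 0 0 t)
      (mom f α 0 0 2 0 0 t / mom f α 0 0 0 0 0 t)
      (mom f α 0 3 0 0 0 t / mom f α 0 0 0 0 0 t)
      (mom f α 2 2 0 0 0 t / mom f α 0 0 0 0 0 t)
      (mom f α 6 0 0 0 0 t / mom f α 0 0 0 0 0 t)
      (mom f α 4 0 0 0 0 t / mom f α 0 0 0 0 0 t)
      (mom f α 0 2 0 0 0 t / mom f α 0 0 0 0 0 t)
      (mom f α 2 0 0 0 0 t / mom f α 0 0 0 0 0 t) a0 a1 a2 a3 a4 a5 a6 a7 := by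
  have hM := mom_zero_pos h ht
  have hJ := (((((((((((((((((((((((((((((((((((((HasJ.mon h t 0 0 0 2 0).smul h (1*a0*a0)).add h ht
    ((HasJ.mon h t 1 0 1 1 0).smul h (2*a0*a1))).add h ht
    ((HasJ.mon h t 0 2 0 1 0).smul h (2*a0*a2))).add h ht
    ((HasJ.mon h t 2 1 0 1 0).smul h (2*a0*a3))).add h ht
    ((HasJ.mon h t 4 0 0 1 0).smul h (2*a0*a4))).add h ht
    ((HasJ.mon h t 2 0 0 1 0).smul h (2*a0*a5))).add h ht
    ((HasJ.mon h t 0 1 0 1 0).smul h (2*a0*a6))).add h ht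
    ((HasJ.mon h t 0 0 0 1 0).smul h (2*a0*a7))).add h ht
    ((HasJ.mon h t 2 0 2 0 0).smul h (1*a1*a1))).add h ht
    ((HasJ.mon h t 1 2 1 0 0).smul h (2*a1*a2))).add h ht
    ((HasJ.mon h t 3 1 1 0 0).smul h (2*a1*a3))).add h ht
    ((HasJ.mon h t 5 0 1 0 0).smul h (2*a1*a4))).add h ht
    ((HasJ.mon h t 3 0 1 0 0).smul h (2*a1*a5))).add h ht
    ((HasJ.mon h t 1 1 1 0 0).smul h (2*a1*a6))).add h ht
    ((HasJ.mon h t 1 0 1 0 0).smul h (2*a1*a7))).add h ht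
    ((HasJ.mon h t 0 4 0 0 0).smul h (1*a2*a2))).add h ht
    ((HasJ.mon h t 2 3 0 0 0).smul h (2*a2*a3))).add h ht
    ((HasJ.mon h t 4 2 0 0 0).smul h (2*a2*a4))).add h ht
    ((HasJ.mon h t 2 2 0 0 0).smul h (2*a2*a5))).add h ht
    ((HasJ.mon h t 0 3 0 0 0).smul h (2*a2*a6))).add h ht
    ((HasJ.mon h t 0 2 0 0 0).smul h (2*a2*a7))).add h ht
    ((HasJ.mon h t 4 2 0 0 0).smul h (1*a3*a3))).add h ht
    ((HasJ.mon h t 6 1 0 0 0).smul h (2*a3*a4))).add h ht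
    ((HasJ.mon h t 4 1 0 0 0).smul h (2*a3*a5))).add h ht
    ((HasJ.mon h t 2 2 0 0 0).smul h (2*a3*a6))).add h ht
    ((HasJ.mon h t 2 1 0 0 0).smul h (2*a3*a7))).add h ht
    ((HasJ.mon h t 8 0 0 0 0).smul h (1*a4*a4))).add h ht
    ((HasJ.mon h t 6 0 0 0 0).smul h (2*a4*a5))).add h ht
    ((HasJ.mon h t 4 1 0 0 0).smul h (2*a4*a6))).add h ht
    ((HasJ.mon h t 4 0 0 0 0).smul h (2*a4*a7))).add h ht
    ((HasJ.mon h t 4 0 0 0 0).smul h (1*a5*a5))).add h ht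
    ((HasJ.mon h t 2 1 0 0 0).smul h (2*a5*a6))).add h ht
    ((HasJ.mon h t 2 0 0 0 0).smul h (2*a5*a7))).add h ht
    ((HasJ.mon h t 0 2 0 0 0).smul h (1*a6*a6))).add h ht
    ((HasJ.mon h t 0 1 0 0 0).smul h (2*a6*a7))).add h ht
    ((HasJ.mon h t 0 0 0 0 0).smul h (1*a7*a7)))
  have hI : 0 ≤ ∫ x, (a0 * (w4 f α t x) + a1 * (w1 f α t x * w3 f α t x) + a2 * (w2 f α t x ^ 2) + a3 * (w1 f α t x ^ 2 * w2 f α t x) + a4 * (w1 f α t x ^ 4) + a5 * (w1 f α t x ^ 2) + a6 * (w2 f α t x) + a7 * (1)) ^ 2 * heatP f t x ^ α := by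
    apply integral_nonneg
    intro x
    have := Real.rpow_pos_of_pos (heatP_pos h ht x) α
    simp only [Pi.zero_apply]
    positivity
  have hE : ∫ x, (a0 * (w4 f α t x) + a1 * (w1 f α t x * w3 f α t x) + a2 * (w2 f α t x ^ 2) + a3 * (w1 f α t x ^ 2 * w2 f α t x) + a4 * (w1 f α t x ^ 4) + a5 * (w1 f α t x ^ 2) + a6 * (w2 f α t x) + a7 * (1)) ^ 2 * heatP f t x ^ α = _ := Eq.trans (by
    congr 1; ext x
    congr 1
    simp only [mon]
    ring) hJ.2
  rw [hE] at hI
  have r_1_0_2_0 : (1)*mom f α 0 1 2 0 0 t + (2)*mom f α 1 0 1 1 0 t + (1)*mom f α 2 0 2 0 0 t = 0 := by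
    have := mom_ibp h ht 1 0 2 0
    norm_num at this ⊢
    linarith
  have r_0_2_1_0 : (2)*mom f α 0 1 2 0 0 t + (1)*mom f α 0 2 0 1 0 t + (1)*mom f α 1 2 1 0 0 t = 0 := by
    have := mom_ibp h ht 0 2 1 0
    norm_num at this ⊢
    linarith
  have r_1_3_0_0 : (1)*mom f α 0 4 0 0 0 t + (3)*mom f α 1 2 1 0 0 t + (1)*mom f α 2 3 0 0 0 t = 0 := by
    have := mom_ibp h ht 1 3 0 0
    norm_num at this ⊢
    linarith
  have r_2_1_1_0 : (2)*mom f α 1 2 1 0 0 t + (1)*mom f α 2 0 2 0 0 t + (1)*mom f α 2 1 0 1 0 t + (1)*mom f α 3 1 1 0 0 t = 0 := by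
    have := mom_ibp h ht 2 1 1 0
    norm_num at this ⊢
    linarith
  have r_3_2_0_0 : (3)*mom f α 2 3 0 0 0 t + (2)*mom f α 3 1 1 0 0 t + (1)*mom f α 4 2 0 0 0 t = 0 := by
    have := mom_ibp h ht 3 2 0 0
    norm_num at this ⊢
    linarith
  have r_4_0_1_0 : (4)*mom f α 3 1 1 0 0 t + (1)*mom f α 4 0 0 1 0 t + (1)*mom f α 5 0 1 0 0 t = 0 := by
    have := mom_ibp h ht 4 0 1 0
    norm_num at this ⊢
    linarith
  have r_5_1_0_0 : (5)*mom f α 4 2 0 0 0 t + (1)*mom f α 5 0 1 0 0 t + (1)*mom f α 6 1 0 0 0 t = 0 := by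
    have := mom_ibp h ht 5 1 0 0
    norm_num at this ⊢
    linarith
  have r_7_0_0_0 : (7)*mom f α 6 1 0 0 0 t + (1)*mom f α 8 0 0 0 0 t = 0 := by
    have := mom_ibp h ht 7 0 0 0
    norm_num at this ⊢
    linarith
  have r_2_0_1_0 : (2)*mom f α 1 1 1 0 0 t + (1)*mom f α 2 0 0 1 0 t + (1)*mom f α 3 0 1 0 0 t = 0 := by
    have := mom_ibp h ht 2 0 1 0
    norm_num at this ⊢
    linarith
  have r_3_1_0_0 : (3)*mom f α 2 2 0 0 0 t + (1)*mom f α 3 0 1 0 0 t + (1)*mom f α 4 1 0 0 0 t = 0 := by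
    have := mom_ibp h ht 3 1 0 0
    norm_num at this ⊢
    linarith
  have r_1_2_0_0 : (1)*mom f α 0 3 0 0 0 t + (2)*mom f α 1 1 1 0 0 t + (1)*mom f α 2 2 0 0 0 t = 0 := by
    have := mom_ibp h ht 1 2 0 0
    norm_num at this ⊢
    linarith
  have r_5_0_0_0 : (5)*mom f α 4 1 0 0 0 t + (1)*mom f α 6 0 0 0 0 t = 0 := by
    have := mom_ibp h ht 5 0 0 0
    norm_num at this ⊢
    linarith
  have r_0_1_1_0 : (1)*mom f α 0 0 2 0 0 t + (1)*mom f α 0 1 0 1 0 t + (1)*mom f α 1 1 1 0 0 t = 0 := by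
    have := mom_ibp h ht 0 1 1 0
    norm_num at this ⊢
    linarith
  have r_0_0_1_0 : (1)*mom f α 0 0 0 1 0 t + (1)*mom f α 1 0 1 0 0 t = 0 := by
    have := mom_ibp h ht 0 0 1 0
    norm_num at this ⊢
    linarith
  have r_1_1_0_0 : (1)*mom f α 0 2 0 0 0 t + (1)*mom f α 1 0 1 0 0 t + (1)*mom f α 2 1 0 0 0 t = 0 := by
    have := mom_ibp h ht 1 1 0 0
    norm_num at this ⊢
    linarith
  have r_3_0_0_0 : (3)*mom f α 2 1 0 0 0 t + (1)*mom f α 4 0 0 0 0 t = 0 := by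
    have := mom_ibp h ht 3 0 0 0
    norm_num at this ⊢
    linarith
  have r_1_0_0_0 : (1)*mom f α 0 1 0 0 0 t + (1)*mom f α 2 0 0 0 0 t = 0 := by
    have := mom_ibp h ht 1 0 0 0
    norm_num at this ⊢
    linarith
  have key : QF (mom f α 0 0 0 2 0 t / mom f α 0 0 0 0 0 t)
      (mom f α 0 1 2 0 0 t / mom f α 0 0 0 0 0 t)
      (mom f α 2 0 2 0 0 t / mom f α 0 0 0 0 0 t)
      (mom f α 0 4 0 0 0 t / mom f α 0 0 0 0 0 t)
      (mom f α 2 3 0 0 0 t / mom f α 0 0 0 0 0 t)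
      (mom f α 4 2 0 0 0 t / mom f α 0 0 0 0 0 t)
      (mom f α 8 0 0 0 0 t / mom f α 0 0 0 0 0 t)
      (mom f α 0 0 2 0 0 t / mom f α 0 0 0 0 0 t)
      (mom f α 0 3 0 0 0 t / mom f α 0 0 0 0 0 t)
      (mom f α 2 2 0 0 0 t / mom f α 0 0 0 0 0 t)
      (mom f α 6 0 0 0 0 t / mom f α 0 0 0 0 0 t)
      (mom f α 4 0 0 0 0 t / mom f α 0 0 0 0 0 t)
      (mom f α 0 2 0 0 0 t / mom f α 0 0 0 0 0 t)
      (mom f α 2 0 0 0 0 t / mom f α 0 0 0 0 0 t) a0 a1 a2 a3 a4 a5 a6 a7 * mom f α 0 0 0 0 0 t = (1*a0*a0)*mom f α 0 0 0 2 0 t + (2*a0*a1)*mom f α 1 0 1 1 0 t + (2*a0*a2)*mom f α 0 2 0 1 0 t + (2*a0*a3)*mom f α 2 1 0 1 0 t + (2*a0*a4)*mom f α 4 0 0 1 0 t + (2*a0*a5)*mom f α 2 0 0 1 0 t + (2*a0*a6)*mom f α 0 1 0 1 0 t + (2*a0*a7)*mom f α 0 0 0 1 0 t + (1*a1*a1)*mom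 f α 2 0 2 0 0 t + (2*a1*a2)*mom f α 1 2 1 0 0 t + (2*a1*a3)*mom f α 3 1 1 0 0 t + (2*a1*a4)*mom f α 5 0 1 0 0 t + (2*a1*a5)*mom f α 3 0 1 0 0 t + (2*a1*a6)*mom f α 1 1 1 0 0 t + (2*a1*a7)*mom f α 1 0 1 0 0 t + (1*a2*a2)*mom f α 0 4 0 0 0 t + (2*a2*a3)*mom f α 2 3 0 0 0 t + (2*a2*a4)*mom f α 4 2 0 0 0 t + (2*a2*a5)*mom f α 2 2 0 0 0 t + (2*a2*a6)*mom f α 0 3 0 0 0 t + (2*a2*a7)*mom f α 0 2 0 0 0 t + (1*a3*a3)*mom f α 4 2 0 0 0 t + (2*a3*a4)*mom f α 6 1 0 0 0 t + (2*a3*a5)*mom f α 4 1 0 0 0 t + (2*a3*a6)*mom f α 2 2 0 0 0 t + (2*a3*a7)*mom f α 2 1 0 0 0 t + (1*a4*a4)*mom f α 8 0 0 0 0 t + (2*a4*a5)*mom f α 6 0 0 0 0 t + (2*a4*a6)*mom f α 4 1 0 0 0 t + (2*a4*a7)*mom f α 4 0 0 0 0 t + (1*a5*a5)*mom f α 4 0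 0 0 0 t + (2*a5*a6)*mom f α 2 1 0 0 0 t + (2*a5*a7)*mom f α 2 0 0 0 0 t + (1*a6*a6)*mom f α 0 2 0 0 0 t + (2*a6*a7)*mom f α 0 1 0 0 0 t + (1*a7*a7)*mom f α 0 0 0 0 0 t := by
    have hM' := hM.ne'
    simp only [QF]
    field_simp
    linear_combination 105 * ((-((1)*a0*a1))*r_1_0_2_0 + (-((2)*a0*a2))*r_0_2_1_0 + (-((-2/3)*a0*a2 + (-4/3)*a0*a3 + (2/3)*a1*a2))*r_1_3_0_0 + (-((2)*a0*a3))*r_2_1_1_0 + (-((-1)*a0*a3 + (-4)*a0*a4 + (1)*a1*a3))*r_3_2_0_0 + (-((2)*a0*a4))*r_4_0_1_0 + (-((-2)*a0*a4 + (2)*a1*a4))*r_5_1_0_0 + (-((2/7)*a0*a4 + (-2/7)*a1*a4 + (2/7)*a3*a4))*r_7_0_0_0 + (-((2)*a0*a5))*r_2_0_1_0 + (-((-2)*a0*a5 + (2)*a1*a5))*r_3_1_0_0 + (-((-2)*a0*a5 + (-1)*a0*a6 + (1)*a1*a6))*r_1_2_0_0 + (-((2/5)*a0*a5 + (-2/5)*a1*a5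 + (2/5)*a3*a5 + (2/5)*a4*a6))*r_5_0_0_0 + (-((2)*a0*a6))*r_0_1_1_0 + (-((2)*a0*a7))*r_0_0_1_0 + (-((-2)*a0*a7 + (2)*a1*a7))*r_1_1_0_0 + (-((2/3)*a0*a7 + (-2/3)*a1*a7 + (2/3)*a3*a7 + (2/3)*a5*a6))*r_3_0_0_0 + (-((2)*a6*a7))*r_1_0_0_0)
  have h2 : 0 ≤ QF (mom f α 0 0 0 2 0 t / mom f α 0 0 0 0 0 t)
      (mom f α 0 1 2 0 0 t / mom f α 0 0 0 0 0 t)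
      (mom f α 2 0 2 0 0 t / mom f α 0 0 0 0 0 t)
      (mom f α 0 4 0 0 0 t / mom f α 0 0 0 0 0 t)
      (mom f α 2 3 0 0 0 t / mom f α 0 0 0 0 0 t)
      (mom f α 4 2 0 0 0 t / mom f α 0 0 0 0 0 t)
      (mom f α 8 0 0 0 0 t / mom f α 0 0 0 0 0 t)
      (mom f α 0 0 2 0 0 t / mom f α 0 0 0 0 0 t)
      (mom f α 0 3 0 0 0 t / mom f α 0 0 0 0 0 t)
      (mom f α 2 2 0 0 0 t / mom f α 0 0 0 0 0 t)
      (mom f α 6 0 0 0 0 t / mom f α 0 0 0 0 0 t)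
      (mom f α 4 0 0 0 0 t / mom f α 0 0 0 0 0 t)
      (mom f α 0 2 0 0 0 t / mom f α 0 0 0 0 0 t)
      (mom f α 2 0 0 0 0 t / mom f α 0 0 0 0 0 t) a0 a1 a2 a3 a4 a5 a6 a7 * mom f α 0 0 0 0 0 t := by
    rw [key]; exact hI
  exact nonneg_of_mul_nonneg_left h2 hM

lemma iter4 {I : Set ℝ} (hI : IsOpen I) {h0 g1 g2 g3 : ℝ → ℝ} {g4 : ℝ → ℝ}
    (h1 : ∀ τ ∈ I, HasDerivAt h0 (g1 τ) τ) (h2 : ∀ τ ∈ I, HasDerivAt g1 (g2 τ) τ)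
    (h3 : ∀ τ ∈ I, HasDerivAt g2 (g3 τ) τ) (h4 : ∀ τ ∈ I, HasDerivAt g3 (g4 τ) τ)
    {t : ℝ} (ht : t ∈ I) : iteratedDeriv 4 h0 t = g4 t := by
  have step : ∀ (n : ℕ) (u v : ℝ → ℝ), (∀ τ ∈ I, iteratedDeriv n h0 τ = u τ) →
      (∀ τ ∈ I, HasDerivAt u (v τ) τ) → ∀ τ ∈ I, iteratedDeriv (n + 1) h0 τ = v τ := by
    intro n u v hu hv τ hτ
    rw [iteratedDeriv_succ]
    have : iteratedDeriv n h0 =ᶠ[nhds τ] u := by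
      filter_upwards [hI.mem_nhds hτ] with σ hσ using hu σ hσ
    rw [this.deriv_eq]
    exact (hv τ hτ).deriv
  have s0 : ∀ τ ∈ I, iteratedDeriv 0 h0 τ = h0 τ := fun τ _ => by simp
  exact step 3 _ _ (step 2 _ _ (step 1 _ _ (step 0 _ _ s0 h1) h2) h3) h4 t ht

lemma main_of (h : Ctx f α a b s) {t : ℝ} (ht : t ∈ Set.Ioo a b) (hl : 0.93 ≤ α) (hu : α ≤ 1.76)
    {h0 : ℝ → ℝ} {κ : ℝ} (hκ : 0 ≤ κ)
    (H : ∀ τ ∈ Set.Ioo a b, HasDerivAt h0 (κ * (mom f α 2 0 0 0 0 τ / mom f α 0 0 0 0 0 τ)) τ) :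
    iteratedDeriv 4 h0 t ≤ 0 := by
  set N := fun τ => mom f α 2 0 0 0 0 τ with hN
  set M := fun τ => mom f α 0 0 0 0 0 τ with hM
  set σ := α⁻¹ with hσ
  have hMp : ∀ τ ∈ Set.Ioo a b, 0 < M τ := fun τ hτ => mom_zero_pos h hτ
  have dM : ∀ τ ∈ Set.Ioo a b, HasDerivAt M (1 / 2 * ((σ - 1) * N τ)) τ := fun τ hτ => M_dt h hτ
  have dN : ∀ τ ∈ Set.Ioo a b, HasDerivAt N (1 / 2 * J1 f α τ) τ := fun τ hτ => J0_dt h hτ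
  have d1 : ∀ τ ∈ Set.Ioo a b, HasDerivAt (fun τ => J1 f α τ) (1 / 2 * J2 f α τ) τ :=
    fun τ hτ => J1_dt h hτ
  have d2 : ∀ τ ∈ Set.Ioo a b, HasDerivAt (fun τ => J2 f α τ) (1 / 2 * J3 f α τ) τ :=
    fun τ hτ => J2_dt h hτ
  have e1 : ∀ τ ∈ Set.Ioo a b, HasDerivAt (fun τ => κ * (N τ / M τ))
      (κ / 2 * (J1 f α τ / M τ - (σ - 1) * (N τ / M τ) ^ 2)) τ := by
    intro τ hτ
    have hm := (hMp τ hτ).ne'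
    refine (((dN τ hτ).fun_div (dM τ hτ) hm).const_mul κ).congr_deriv ?_
    field_simp
  have e2 : ∀ τ ∈ Set.Ioo a b, HasDerivAt
      (fun τ => κ / 2 * (J1 f α τ / M τ - (σ - 1) * (N τ / M τ) ^ 2))
      (κ / 4 * (J2 f α τ / M τ - 3 * (σ - 1) * (N τ / M τ) * (J1 f α τ / M τ)
        + 2 * (σ - 1) ^ 2 * (N τ / M τ) ^ 3)) τ := by
    intro τ hτ
    have hm := (hMp τ hτ).ne'
    refine ((((d1 τ hτ).fun_div (dM τ hτ) hm).fun_sub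
      ((((dN τ hτ).fun_div (dM τ hτ) hm).fun_pow 2).const_mul (σ - 1))).const_mul (κ / 2)).congr_deriv ?_
    simp only [Nat.cast_ofNat, Nat.reduceSub, pow_one]
    field_simp
    ring
  have e3 : ∀ τ ∈ Set.Ioo a b, HasDerivAt
      (fun τ => κ / 4 * (J2 f α τ / M τ - 3 * (σ - 1) * (N τ / M τ) * (J1 f α τ / M τ)
        + 2 * (σ - 1) ^ 2 * (N τ / M τ) ^ 3))
      (κ / 8 * (J3 f α τ / M τ - 4 * (σ - 1) * (N τ / M τ) * (J2 f α τ / M τ)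
        - 3 * (σ - 1) * (J1 f α τ / M τ) ^ 2 + 12 * (σ - 1) ^ 2 * (N τ / M τ) ^ 2 * (J1 f α τ / M τ)
        - 6 * (σ - 1) ^ 3 * (N τ / M τ) ^ 4)) τ := by
    intro τ hτ
    have hm := (hMp τ hτ).ne'
    refine (((((d2 τ hτ).fun_div (dM τ hτ) hm).fun_sub
      ((((dN τ hτ).fun_div (dM τ hτ) hm).const_mul (3 * (σ - 1))).fun_mul
        ((d1 τ hτ).fun_div (dM τ hτ) hm))).fun_add
      ((((dN τ hτ).fun_div (dM τ hτ) hm).fun_pow 3).const_mul (2 * (σ - 1) ^ 2))).const_mul (κ / 4)).congr_deriv ?_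
    simp only [Nat.cast_ofNat, Nat.reduceSub]
    field_simp
    ring
  rw [iter4 isOpen_Ioo H e1 e2 e3 ht]
  have hα0 : 0 < α := by linarith [h.hα]
  have hs1 : 71/125 ≤ σ := by
    rw [hσ, le_inv_comm₀ (by norm_num) hα0]; norm_num at hu ⊢; linarith
  have hs2 : σ ≤ 5377/5000 := by
    rw [hσ, inv_le_comm₀ hα0 (by norm_num)]; norm_num at hl ⊢; linarith
  have key := cert_all (QF_nonneg h ht) σ hs1 hs2
  apply mul_nonpos_of_nonneg_of_nonpos (by positivity)
  have hm := (hMp t ht).ne'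
  rw [← neg_nonneg]
  refine key.trans (le_of_eq ?_)
  simp only [TT0, TT1, TT2, TT3, J1, J2, J3, hN, hM, ← hσ] at hm ⊢
  field_simp
  ring

end A

/-! ### Conclusion -/

lemma QQ_zero_integrable {f : ℝ → ℝ} (hfi : Integrable f) {t : ℝ} (ht : 0 < t) :
    Integrable (fun x => QQ f 0 t x) := by
  have hb : 0 < 1 / (2 * t) := by positivity
  refine (hfi.integrable_convolution (ContinuousLinearMap.mul ℝ ℝ)
    (integrable_exp_neg_mul_sq hb)).congr (Eventually.of_forall fun x => ?_)
  simp only [convolution_def, QQ, ContinuousLinearMap.mul_apply']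
  congr 1; ext y
  rw [pow_zero, one_mul]
  congr 2; ring

lemma QQ_zero_integral {f : ℝ → ℝ} (hfi : Integrable f) (hf1 : (∫ x : ℝ, f x) = 1) {t : ℝ}
    (ht : 0 < t) : ∫ x, QQ f 0 t x = Real.sqrt (2 * Real.pi * t) := by
  have hb : 0 < 1 / (2 * t) := by positivity
  have h := integral_convolution (ContinuousLinearMap.mul ℝ ℝ) hfi (integrable_exp_neg_mul_sq hb)
  rw [integral_gaussian, hf1, ContinuousLinearMap.mul_apply', one_mul] at h
  rw [show 2 * Real.pi * t = Real.pi / (1 / (2 * t)) by field_simp, ← h]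
  congr 1; ext x
  simp only [convolution_def, QQ, ContinuousLinearMap.mul_apply']
  congr 1; ext y
  rw [pow_zero, one_mul]
  congr 2; ring

section C
variable {f : ℝ → ℝ} {α a b s : ℝ}

lemma mom_zero_eq (t : ℝ) : mom f α 0 0 0 0 0 t = ∫ x, heatP f t x ^ α := by
  unfold mom
  congr 1; ext x
  simp [mon]

lemma renyi_dt (h : Ctx f α a b s) (hα1 : α ≠ 1) {t : ℝ} (ht : t ∈ Set.Ioo a b) :
    HasDerivAt (fun t => renyiEnt f α t)
      (1 / (2 * α) * (mom f α 2 0 0 0 0 t / mom f α 0 0 0 0 0 t)) t := by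
  have e : (fun t => renyiEnt f α t) = fun t => (1 - α)⁻¹ * Real.log (mom f α 0 0 0 0 0 t) := by
    ext τ
    rw [renyiEnt, if_neg hα1, mom_zero_eq]
  rw [e]
  have hM := (mom_zero_pos h ht).ne'
  have hα : 0 < α := by linarith [h.hα]
  have h1 : 1 - α ≠ 0 := sub_ne_zero.mpr (Ne.symm hα1)
  refine (((M_dt h ht).log hM).const_mul _).congr_deriv ?_
  field_simp

/-- `log p - log Q_s` is tame. -/
lemma nice_log (h : Ctx f α a b s) :
    Nice f a b s (fun t x => Real.log (heatP f t x) - Real.log (QQ f 0 s x)) := by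
  have hs0 : 0 < s := by linarith [h.hbs, h.hab, h.ha]
  refine ⟨fun η hη => ?_, fun t ht => ?_⟩
  · set L := |Real.log (Real.sqrt (2 * Real.pi * a))| + |Real.log (Real.sqrt (2 * Real.pi * b))| with hL
    refine ⟨L + 1 / η, by positivity, fun t ht x => ?_⟩
    have ht0 : 0 < t := h.ha.trans ht.1
    have ha := h.ha
    have hq := QQ_pos h.hf0 h.hf1 h.hfi ht0 x
    have hqs := QQ_pos h.hf0 h.hf1 h.hfi hs0 x
    have hr := h.ratio ht x
    have e : Real.log (heatP f t x) - Real.log (QQ f 0 s x)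
        = -Real.log (Real.sqrt (2 * Real.pi * t)) - Real.log (QQ f 0 s x / QQ f 0 t x) := by
      rw [heatP_eq h, Real.log_mul (by positivity) hq.ne', Real.log_div hqs.ne' hq.ne', Real.log_inv]
      ring
    beta_reduce
    rw [e]
    have l1 := Real.one_le_rpow hr hη.le
    have l2 := Real.log_le_rpow_div (by linarith : 0 ≤ QQ f 0 s x / QQ f 0 t x) hη
    have l3 := Real.log_nonneg hr
    have l4 : |Real.log (Real.sqrt (2 * Real.pi * t))| ≤ L := by
      have m1 : Real.log (Real.sqrt (2 * Real.pi * a)) ≤ Real.log (Real.sqrt (2 * Real.pi * t)) := by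
        apply Real.log_le_log (by positivity)
        apply Real.sqrt_le_sqrt
        have := ht.1.le
        gcongr
      have m2 : Real.log (Real.sqrt (2 * Real.pi * t)) ≤ Real.log (Real.sqrt (2 * Real.pi * b)) := by
        apply Real.log_le_log (by positivity)
        apply Real.sqrt_le_sqrt
        have := ht.2.le
        gcongr
      rw [abs_le]
      constructor
      · linarith [neg_abs_le (Real.log (Real.sqrt (2 * Real.pi * a))),
          abs_nonneg (Real.log (Real.sqrt (2 * Real.pi * b)))]
      · linarith [le_abs_self (Real.log (Real.sqrt (2 * Real.pi * b))),
          abs_nonneg (Real.log (Real.sqrt (2 * Real.pi * a)))]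
    have hL0 : 0 ≤ L := by positivity
    calc |-Real.log (Real.sqrt (2 * Real.pi * t)) - Real.log (QQ f 0 s x / QQ f 0 t x)|
        ≤ |Real.log (Real.sqrt (2 * Real.pi * t))| + |Real.log (QQ f 0 s x / QQ f 0 t x)| := by
          rw [← abs_neg (Real.log (Real.sqrt (2 * Real.pi * t)))]
          exact abs_sub _ _
      _ ≤ L + (QQ f 0 s x / QQ f 0 t x) ^ η / η := by
          rw [abs_of_nonneg l3]; linarith
      _ ≤ _ := by
          rw [add_mul, one_div, div_eq_inv_mul]
          nlinarith
  · have c1 : Continuous fun x => heatP f t x := by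
      rw [continuous_iff_continuousAt]
      exact fun x => (heatP_dx h ht x).continuousAt
    have c2 : Continuous fun x => QQ f 0 s x := by
      rw [continuous_iff_continuousAt]
      exact fun x => (QQ_hasDerivAt_x h.hfi 0 hs0 x).continuousAt
    exact (c1.log fun x => (heatP_pos h ht x).ne').sub
      (c2.log fun x => (QQ_pos h.hf0 h.hf1 h.hfi hs0 x).ne')

lemma Nice.domlog (h : Ctx f 1 a b s) {w : ℝ → ℝ → ℝ} (hw : Nice f a b s w) :
    ∃ C D : ℝ, ∀ t ∈ Set.Ioo a b, ∀ x,
      |w t x * (heatP f t x * Real.log (heatP f t x))| ≤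
        C * QQ f 0 s x + D * |QQ f 0 s x * Real.log (QQ f 0 s x)| := by
  obtain ⟨C, hC, h1⟩ := (hw.mul h (nice_log h)).dom h
  obtain ⟨D, hD, h2⟩ := hw.dom h
  refine ⟨C, D, fun t ht x => ?_⟩
  have hs0 : 0 < s := by linarith [h.hbs, h.hab, h.ha]
  have hqs := QQ_pos h.hf0 h.hf1 h.hfi hs0 x
  have k1 := h1 t ht x
  have k2 := h2 t ht x
  simp only [Real.rpow_one] at k1 k2
  have e : w t x * (heatP f t x * Real.log (heatP f t x)) =
      w t x * (Real.log (heatP f t x) - Real.log (QQ f 0 s x)) * heatP f t x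
      + w t x * heatP f t x * Real.log (QQ f 0 s x) := by ring
  rw [e]
  refine (abs_add_le _ _).trans (add_le_add k1 ?_)
  rw [abs_mul, abs_mul (QQ f 0 s x), abs_of_pos hqs, ← mul_assoc]
  exact mul_le_mul_of_nonneg_right k2 (abs_nonneg _)

lemma heatP_cont (h : Ctx f α a b s) {t : ℝ} (ht : t ∈ Set.Ioo a b) :
    Continuous fun x => heatP f t x := by
  rw [continuous_iff_continuousAt]
  exact fun x => (heatP_dx h ht x).continuousAt

lemma Nice.intlog (h : Ctx f 1 a b s)
    (hl : Integrable fun x => QQ f 0 s x * Real.log (QQ f 0 s x))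
    {w : ℝ → ℝ → ℝ} (hw : Nice f a b s w) {t : ℝ} (ht : t ∈ Set.Ioo a b) :
    Integrable fun x => w t x * (heatP f t x * Real.log (heatP f t x)) := by
  obtain ⟨C, D, h1⟩ := hw.domlog h
  have hi := h.hintg
  simp only [Real.rpow_one] at hi
  refine ((hi.const_mul C).add (hl.abs.const_mul D)).mono' ?_ (Eventually.of_forall fun x => h1 t ht x)
  have c1 := heatP_cont h ht
  exact ((hw.2 t ht).mul (c1.mul (c1.log fun x => (heatP_pos h ht x).ne'))).aestronglyMeasurable

lemma shannon_dt (h : Ctx f 1 a b s)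
    (hl : Integrable fun x => QQ f 0 s x * Real.log (QQ f 0 s x)) {t : ℝ} (ht : t ∈ Set.Ioo a b) :
    HasDerivAt (fun t => renyiEnt f 1 t)
      (1 / 2 * (mom f 1 2 0 0 0 0 t / mom f 1 0 0 0 0 0 t)) t := by
  have ht0 : 0 < t := h.ha.trans ht.1
  have hM : mom f 1 0 0 0 0 0 t = 1 := by
    rw [mom_zero_eq]
    simp only [Real.rpow_one, heatP_eq h]
    rw [integral_const_mul, QQ_zero_integral h.hfi h.hf1 ht0]
    apply inv_mul_cancel₀
    positivity
  rw [hM, div_one]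
  have e : (fun t => renyiEnt f 1 t) = fun t => -∫ x, heatP f t x * Real.log (heatP f t x) := by
    ext τ
    rw [renyiEnt, if_pos rfl]
  rw [e]
  have hg : Nice f a b s (fun t x => w2 f 1 t x + w1 f 1 t x ^ 2) :=
    (nice_w2 h).add ((nice_w1 h).pow h 2)
  have hi := h.hintg
  simp only [Real.rpow_one] at hi
  have i1 := hg.intlog h hl ht
  have i2 := hg.integrable h ht
  have i3 := (nice_mon h 2 0 0 0 0).integrable h ht
  simp only [Real.rpow_one] at i2 i3
  -- integration by parts
  have z1 : ∫ x, (w2 f 1 t x + w1 f 1 t x ^ 2) * heatP f t x = 0 := by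
    have := Nice.ibp h (nice_w1 h) (nice_w2 h) ht (fun x => w1_dx h ht x)
    rw [← this]
    congr 1; ext x
    rw [Real.rpow_one]; ring
  have z2 : ∫ x, ((w2 f 1 t x + w1 f 1 t x ^ 2) * (heatP f t x * Real.log (heatP f t x))
      + mon f 1 2 0 0 0 0 t x * heatP f t x) = 0 := by
    apply integral_eq_zero_of_hasDerivAt_of_integrable
      (f := fun x => w1 f 1 t x * (heatP f t x * Real.log (heatP f t x)))
    · intro x
      have hp := heatP_pos h ht x
      have d := heatP_dx h ht x
      refine ((w1_dx h ht x).fun_mul (d.fun_mul (d.log hp.ne'))).congr_deriv ?_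
      simp only [mon]
      field_simp
      ring
    · exact i1.add i3
    · exact (nice_w1 h).intlog h hl ht
  rw [integral_add i1 i3] at z2
  have hN : mom f 1 2 0 0 0 0 t = ∫ x, mon f 1 2 0 0 0 0 t x * heatP f t x := by
    simp only [mom, Real.rpow_one]
  obtain ⟨C, D, k1⟩ := hg.domlog h
  obtain ⟨C', hC', k2⟩ := hg.dom h
  simp only [Real.rpow_one] at k2
  have hmem : Set.Ioo a b ∈ nhds t := Ioo_mem_nhds ht.1 ht.2
  have hone : ∀ τ ∈ Set.Ioo a b, Integrable fun x => heatP f τ x * Real.log (heatP f τ x) := by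
    intro τ hτ
    simpa using (Nice.const h 1).intlog h hl hτ
  have hd := (hasDerivAt_integral_of_dominated_loc_of_deriv_le (μ := volume) (𝕜 := ℝ)
    (F := fun t x => heatP f t x * Real.log (heatP f t x))
    (F' := fun t x => 1 / 2 * ((w2 f 1 t x + w1 f 1 t x ^ 2) * (heatP f t x * Real.log (heatP f t x))
      + (w2 f 1 t x + w1 f 1 t x ^ 2) * heatP f t x))
    (bound := fun x => 1 / 2 * ((C * QQ f 0 s x + D * |QQ f 0 s x * Real.log (QQ f 0 s x)|)
      + C' * QQ f 0 s x))
    (x₀ := t) (s := Set.Ioo a b) hmem ?_ ?_ ?_ ?_ ?_ ?_).2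
  · refine hd.fun_neg.congr_deriv ?_
    rw [integral_const_mul, integral_add i1 i2, z1, hN]
    linarith
  · filter_upwards [hmem] with τ hτ
    exact (hone τ hτ).aestronglyMeasurable
  · exact hone t ht
  · exact ((i1.add i2).const_mul (1 / 2)).aestronglyMeasurable
  · refine Eventually.of_forall fun x τ hτ => ?_
    rw [Real.norm_eq_abs, abs_mul, abs_of_pos (by norm_num : (0:ℝ) < 1 / 2)]
    apply mul_le_mul_of_nonneg_left _ (by norm_num)
    exact (abs_add_le _ _).trans (add_le_add (k1 τ hτ x) (k2 τ hτ x))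
  · exact (((hi.const_mul C).add (hl.abs.const_mul D)).add (hi.const_mul C')).const_mul (1 / 2)
  · refine Eventually.of_forall fun x τ hτ => ?_
    have hp := heatP_pos h hτ x
    have d := heatP_dt h hτ x
    refine (d.fun_mul (d.log hp.ne')).congr_deriv ?_
    field_simp

end C

/-- Nonpositivity of the fourth-order derivative of the Rényi entropy along the heat
flow, for orders α ∈ [0.93, 1.76]. -/
theorem renyi_fourth_derivative_nonpos
    (f : ℝ → ℝ) (hfm : Measurable f) (hf0 : ∀ x, 0 ≤ f x)
    (hf1 : (∫ x : ℝ, f x) = 1)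
    (α : ℝ) (hαl : 0.93 ≤ α) (hαu : α ≤ 1.76)
    (t : ℝ) (ht : 0 < t) (htα : ltTalpha f α t) :
    iteratedDeriv 4 (fun s => renyiEnt f α s) t ≤ 0 := by
  have hfi : Integrable f := by
    by_contra hn
    rw [integral_undef hn] at hf1
    norm_num at hf1
  obtain ⟨s, hts, hs, hfin⟩ := htα
  have hαh : 1 / 2 ≤ α := by norm_num at hαl ⊢; linarith
  have hα0 : 0 < α := by linarith
  have hc : 0 < (Real.sqrt (2 * Real.pi * s))⁻¹ := by positivity
  have hpe : ∀ x, heatP f s x = (Real.sqrt (2 * Real.pi * s))⁻¹ * QQ f 0 s x := by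
    intro x
    unfold heatP QQ
    rw [← integral_const_mul]
    congr 1; ext y; ring
  have hq := fun x => QQ_pos hf0 hf1 hfi hs x
  have hmem : t ∈ Set.Ioo (t / 2) ((t + s) / 2) := ⟨by linarith, by linarith⟩
  by_cases hα1 : α = 1
  · subst hα1
    have h : Ctx f 1 (t / 2) ((t + s) / 2) s := by
      refine ⟨hf0, hf1, hfi, by linarith, by linarith, by linarith, hαh, ?_⟩
      simpa using QQ_zero_integrable hfi hs
    rw [renyiFinite, if_pos rfl] at hfin
    have hl : Integrable fun x => QQ f 0 s x * Real.log (QQ f 0 s x) := by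
      set c := (Real.sqrt (2 * Real.pi * s))⁻¹ with hcdef
      have := (hfin.const_mul c⁻¹).sub ((QQ_zero_integrable hfi hs).const_mul (Real.log c))
      refine this.congr (Eventually.of_forall fun x => ?_)
      simp only [Pi.sub_apply, hpe]
      rw [Real.log_mul hc.ne' (hq x).ne']
      field_simp
      ring
    exact main_of h hmem hαl hαu (κ := 1 / 2) (by norm_num) (fun τ hτ => shannon_dt h hl hτ)
  · rw [renyiFinite, if_neg hα1] at hfin
    have h : Ctx f α (t / 2) ((t + s) / 2) s := by
      refine ⟨hf0, hf1, hfi, by linarith, by linarith, by linarith, hαh, ?_⟩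
      refine (hfin.1.const_mul (((Real.sqrt (2 * Real.pi * s))⁻¹ ^ α)⁻¹)).congr
        (Eventually.of_forall fun x => ?_)
      have := Real.rpow_pos_of_pos hc α
      simp only [hpe]
      rw [Real.mul_rpow hc.le (hq x).le, inv_mul_cancel_left₀ this.ne']
    exact main_of h hmem hαl hαu (κ := 1 / (2 * α)) (by positivity) (fun τ hτ => renyi_dt h hα1 hτ)
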